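/- arXiv:math/0409062 — 3 statements merged into one kernel-verified Lean document; each statement's English description precedes it below -/
import Mathlib

section
/- For every integer n ≥ 1, every integer μ ≥ 0, and every x ∈ ℂ, one has E_n(n x)/n! = (1/(π i)) ∮_{|ξ|=1} (e^{x ξ}/ξ)^n F_μ(ξ) dξ + 2 Σ_{k=0}^{μ} [ S_{n-1}(n x (2k+1) π i) / ((2k+1) π i)^{n+1} + S_{n-1}(−n x (2k+1) π i) / (−(2k+1) π i)^{n+1} ]. -/
open scoped Real
open Complex

/-- `S m z` is the `m`-th partial sum of the exponential series. -/
noncomputable def S (m : ℕ) (z : ℂ) : ℂ := ∑ j ∈ Finset.range (m + 1), z ^ j / (Nat.factorial j : ℂ)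

/-- The function `F_μ`. -/
noncomputable def F (μ : ℕ) (ξ : ℂ) : ℂ :=
  1 / (ξ * (Complex.exp ξ + 1)) +
    ∑ k ∈ Finset.range (μ + 1),
      (1 / ((2 * (k : ℂ) + 1) * π * Complex.I * (ξ - (2 * (k : ℂ) + 1) * π * Complex.I)) +
        1 / (-((2 * (k : ℂ) + 1) * π * Complex.I) * (ξ + (2 * (k : ℂ) + 1) * π * Complex.I)))

open Metric in
theorem circleIntegral_exp_mul_div_pow {f : ℂ → ℂ}
    (hf : ∀ z ∈ closedBall (0 : ℂ) 1, DifferentiableAt ℂ f z) (n : ℕ) (y : ℂ) :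
    (∮ ξ in C(0, 1), exp (y * ξ) * f ξ / ξ ^ (n + 1)) =
      2 * π * I * ∑ i ∈ Finset.range (n + 1),
        y ^ i / (Nat.factorial i : ℂ) * (iteratedDeriv (n - i) f 0 / (Nat.factorial (n - i) : ℂ)) := by
  have hfa : AnalyticAt ℂ f 0 :=
    DifferentiableOn.analyticAt (fun z hz => (hf z hz).differentiableWithinAt)
      (closedBall_mem_nhds 0 one_pos)
  have hd : DifferentiableOn ℂ (fun ξ => exp (y * ξ) * f ξ) (closedBall 0 1) := fun z hz =>
    (DifferentiableAt.mul (by fun_prop) (hf z hz)).differentiableWithinAt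
  have hint := hd.circleIntegral_one_div_sub_center_pow_smul one_pos n
  simp only [sub_zero, smul_eq_mul, one_div_mul_eq_div] at hint
  rw [hint, iteratedDeriv_fun_mul (by fun_prop) hfa.contDiffAt, Finset.mul_sum, Finset.mul_sum]
  refine Finset.sum_congr rfl fun i hi => ?_
  have hin : i ≤ n := Nat.lt_succ_iff.mp (Finset.mem_range.mp hi)
  rw [iteratedDeriv_cexp_const_mul, Nat.cast_choose ℂ hin]
  have h1 : (Nat.factorial n : ℂ) ≠ 0 := by exact_mod_cast n.factorial_ne_zero
  simp only [mul_zero, exp_zero, mul_one]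
  field_simp

theorem iteratedDeriv_sub_inv_zero (k : ℕ) {a : ℂ} (ha : a ≠ 0) :
    iteratedDeriv k (fun z => (z - a)⁻¹) 0 = -(Nat.factorial k : ℂ) / a ^ (k + 1) := by
  have h := congrFun (iter_deriv_inv_linear_sub k 1 a) 0
  simp only [one_mul, one_pow, mul_one, zero_sub] at h
  rw [iteratedDeriv_eq_iterate, h, show (-1 - (k : ℤ)) = -((k + 1 : ℕ) : ℤ) by push_cast; ring,
    zpow_neg, zpow_natCast, neg_pow a]
  have h1 : ((-1 : ℂ) ^ k) * (-1) ^ k = 1 := by rw [← mul_pow]; simp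
  have h2 : ((-1 : ℂ) ^ k) ≠ 0 := by simp
  field_simp
  ring

theorem circleIntegral_exp_div_pow_mul_sub (m : ℕ) (y : ℂ) {a : ℂ} (ha : 1 < ‖a‖) :
    (∮ ξ in C(0, 1), exp (y * ξ) * (ξ - a)⁻¹ / ξ ^ (m + 1)) =
      -(2 * π * I) * (S m (y * a) / a ^ (m + 1)) := by
  have ha0 : a ≠ 0 := norm_pos_iff.mp (one_pos.trans ha)
  rw [circleIntegral_exp_mul_div_pow, S, Finset.sum_div, Finset.mul_sum, Finset.mul_sum]
  · refine Finset.sum_congr rfl fun i hi => ?_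
    obtain ⟨d, rfl⟩ := Nat.exists_eq_add_of_le (Nat.lt_succ_iff.mp (Finset.mem_range.mp hi))
    have h1 : (Nat.factorial d : ℂ) ≠ 0 := by exact_mod_cast d.factorial_ne_zero
    have h2 : (Nat.factorial i : ℂ) ≠ 0 := by exact_mod_cast i.factorial_ne_zero
    rw [Nat.add_sub_cancel_left, iteratedDeriv_sub_inv_zero d ha0]
    field_simp
    ring
  · intro z hz
    refine DifferentiableAt.inv (by fun_prop) (sub_ne_zero.mpr ?_)
    rintro rfl
    exact absurd (mem_closedBall_zero_iff.mp hz) (not_le.mpr ha)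

theorem exp_add_one_ne_zero_of_norm_le_one {z : ℂ} (hz : ‖z‖ ≤ 1) : exp z + 1 ≠ 0 := by
  intro h
  have him := abs_le.mp ((abs_im_le_norm z).trans hz)
  have hpi := Real.pi_gt_three
  have hlog := log_exp (x := z) (by linarith) (by linarith)
  rw [eq_neg_of_add_eq_zero_left h, log_neg_one] at hlog
  have : z.im = π := by rw [← hlog]; simp
  linarith

theorem differentiableAt_inv_exp_add_one {z : ℂ} (hz : z ∈ Metric.closedBall (0 : ℂ) 1) :
    DifferentiableAt ℂ (fun ξ => (exp ξ + 1)⁻¹) z :=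
  DifferentiableAt.inv (by fun_prop)
    (exp_add_one_ne_zero_of_norm_le_one (mem_closedBall_zero_iff.mp hz))

theorem Polynomial.eq_zero_of_eval_add_one_add_eval {P : Polynomial ℂ}
    (hP : ∀ x, P.eval (x + 1) + P.eval x = 0) : P = 0 := by
  have h : P.comp (Polynomial.X + 1) = -P := by
    refine Polynomial.funext fun x => ?_
    simpa using eq_neg_of_add_eq_zero_left (hP x)
  have hdeg : (Polynomial.X + 1 : Polynomial ℂ).natDegree = 1 := by
    simpa using Polynomial.natDegree_X_add_C (1 : ℂ)
  have hmonic : (Polynomial.X + 1 : Polynomial ℂ).leadingCoeff = 1 := by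
    simpa using Polynomial.leadingCoeff_X_add_C (1 : ℂ)
  have hlc := congrArg Polynomial.leadingCoeff h
  rw [Polynomial.leadingCoeff_comp (by simp [hdeg]), hmonic, one_pow, mul_one,
    Polynomial.leadingCoeff_neg] at hlc
  exact Polynomial.leadingCoeff_eq_zero.mp (self_eq_neg.mp hlc)

theorem circleIntegrable_exp_mul_div_pow {f : ℂ → ℂ}
    (hf : ∀ z ∈ Metric.sphere (0 : ℂ) 1, DifferentiableAt ℂ f z) (n : ℕ) (y : ℂ) :
    CircleIntegrable (fun ξ => exp (y * ξ) * f ξ / ξ ^ n) 0 1 := by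
  refine ContinuousOn.circleIntegrable zero_le_one fun z hz => ?_
  have hz0 : z ≠ 0 := Metric.ne_of_mem_sphere hz one_ne_zero
  have hnum : DifferentiableAt ℂ (fun ξ => exp (y * ξ) * f ξ) z :=
    DifferentiableAt.mul (by fun_prop) (hf z hz)
  exact (hnum.fun_div (differentiableAt_pow n) (pow_ne_zero n hz0)).continuousAt.continuousWithinAt

theorem eulerPolynomial_eval_eq_circleIntegral {n : ℕ} {P : Polynomial ℂ}
    (hP : ∀ x, P.eval (x + 1) + P.eval x = 2 * x ^ n) (y : ℂ) :
    P.eval y / (Nat.factorial n : ℂ) =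
      1 / (π * I) * ∮ ξ in C(0, 1), exp (y * ξ) * (exp ξ + 1)⁻¹ / ξ ^ (n + 1) := by
  have hpi : (π : ℂ) * I ≠ 0 := mul_ne_zero (mod_cast Real.pi_ne_zero) I_ne_zero
  have hn : (Nat.factorial n : ℂ) ≠ 0 := by exact_mod_cast n.factorial_ne_zero
  set J : ℂ → ℂ := fun y => ∮ ξ in C(0, 1), exp (y * ξ) * (exp ξ + 1)⁻¹ / ξ ^ (n + 1) with hJ
  obtain ⟨G, hG⟩ : ∃ G : Polynomial ℂ, ∀ y, G.eval y = J y := by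
    refine ⟨Polynomial.C (2 * π * I) * ∑ i ∈ Finset.range (n + 1),
      Polynomial.X ^ i * Polynomial.C ((Nat.factorial i : ℂ)⁻¹ *
        (iteratedDeriv (n - i) (fun ξ => (exp ξ + 1)⁻¹) 0 / (Nat.factorial (n - i) : ℂ))),
      fun y => ?_⟩
    simp only [hJ]
    rw [circleIntegral_exp_mul_div_pow (fun _ => differentiableAt_inv_exp_add_one)]
    simp only [Polynomial.eval_mul, Polynomial.eval_C, Polynomial.eval_finsetSum,
      Polynomial.eval_pow, Polynomial.eval_X, div_eq_mul_inv, mul_assoc]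
  have hJadd : ∀ y, J (y + 1) + J y = 2 * π * I * (y ^ n / (Nat.factorial n : ℂ)) := by
    intro y
    have hint : ∀ w, CircleIntegrable
        (fun ξ => exp (w * ξ) * (exp ξ + 1)⁻¹ / ξ ^ (n + 1)) 0 1 := fun w =>
      circleIntegrable_exp_mul_div_pow (fun z hz =>
        differentiableAt_inv_exp_add_one (Metric.sphere_subset_closedBall hz)) _ w
    simp only [hJ]
    rw [← circleIntegral.integral_add (hint _) (hint _)]
    have hone := circleIntegral_exp_mul_div_pow (f := fun _ => 1) (by simp) n y
    rw [Finset.sum_eq_single n] at hone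
    · simp only [Nat.sub_self, iteratedDeriv_zero, Nat.factorial_zero, Nat.cast_one, div_one,
        mul_one] at hone
      rw [← hone]
      refine circleIntegral.integral_congr zero_le_one fun z hz => ?_
      have h1 := exp_add_one_ne_zero_of_norm_le_one (mem_sphere_zero_iff_norm.mp hz).le
      have hz0 : z ≠ 0 := Metric.ne_of_mem_sphere hz one_ne_zero
      simp only [add_mul, one_mul, exp_add]
      field_simp
    · intro i hi hne
      have : n - i ≠ 0 := by have := Finset.mem_range.mp hi; omega
      simp [iteratedDeriv_const, this]
    · simp
  have hD := Polynomial.eq_zero_of_eval_add_one_add_eval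
    (P := P - Polynomial.C (Nat.factorial n / (π * I)) * G) fun x => by
      have h1 := hP x
      have h2 := hJadd x
      simp only [Polynomial.eval_sub, Polynomial.eval_mul, Polynomial.eval_C, hG]
      have h3 : (Nat.factorial n : ℂ) / (π * I) * (J (x + 1) + J x) = 2 * x ^ n := by
        rw [h2]; field_simp
      linear_combination h1 - h3
  have hy := congrArg (Polynomial.eval y) hD
  simp only [Polynomial.eval_sub, Polynomial.eval_mul, Polynomial.eval_C, hG,
    Polynomial.eval_zero] at hy
  rw [sub_eq_zero.mp hy]
  change _ = 1 / (π * I) * J y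
  field_simp

theorem one_lt_norm_odd_mul_pi_mul_I (k : ℕ) : 1 < ‖(2 * (k : ℂ) + 1) * π * I‖ := by
  have h : ‖(2 * (k : ℂ) + 1)‖ = 2 * k + 1 := by
    rw [show (2 * (k : ℂ) + 1) = ((2 * k + 1 : ℕ) : ℂ) by push_cast; ring, norm_natCast]
    push_cast; ring
  rw [norm_mul, norm_mul, h, norm_I, norm_real, Real.norm_of_nonneg Real.pi_pos.le]
  have := Real.pi_gt_three
  have : (0 : ℝ) ≤ k := k.cast_nonneg
  nlinarith

theorem euler_decomposition (E : ℕ → Polynomial ℂ)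
    (hE : ∀ (n : ℕ) (x : ℂ), (E n).eval (x + 1) + (E n).eval x = 2 * x ^ n) :
    ∀ n : ℕ, 1 ≤ n → ∀ μ : ℕ, ∀ x : ℂ,
      (E n).eval (n * x) / (Nat.factorial n : ℂ) =
        (1 / (π * Complex.I)) * (∮ ξ in C(0, 1), (Complex.exp (x * ξ) / ξ) ^ n * F μ ξ)
          + 2 * ∑ k ∈ Finset.range (μ + 1),
              (S (n - 1) ((n : ℂ) * x * (2 * (k : ℂ) + 1) * π * Complex.I)
                  / ((2 * (k : ℂ) + 1) * π * Complex.I) ^ (n + 1)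
                + S (n - 1) (-((n : ℂ) * x * (2 * (k : ℂ) + 1) * π * Complex.I))
                  / (-((2 * (k : ℂ) + 1) * π * Complex.I)) ^ (n + 1)) := by
  intro n hn μ x
  obtain ⟨m, rfl⟩ : ∃ m, n = m + 1 := ⟨n - 1, by omega⟩
  rw [eulerPolynomial_eval_eq_circleIntegral (hE (m + 1))]
  have hpi : (π : ℂ) ≠ 0 := mod_cast Real.pi_ne_zero
  set y : ℂ := ((m + 1 : ℕ) : ℂ) * x with hy
  set a : ℕ → ℂ := fun k => (2 * (k : ℂ) + 1) * π * I with ha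
  have ha1 : ∀ k, 1 < ‖a k‖ := one_lt_norm_odd_mul_pi_mul_I
  have ha1' : ∀ k, 1 < ‖-a k‖ := fun k => by rw [norm_neg]; exact ha1 k
  set Q : ℂ → ℂ → ℂ := fun b ξ => exp (y * ξ) * (ξ - b)⁻¹ / ξ ^ (m + 1) with hQ
  have hQint : ∀ b : ℂ, 1 < ‖b‖ → CircleIntegrable (Q b) 0 1 := fun b hb =>
    circleIntegrable_exp_mul_div_pow (fun z hz => by
      refine DifferentiableAt.inv (by fun_prop) (sub_ne_zero.mpr ?_)
      rintro rfl
      exact hb.ne' (mem_sphere_zero_iff_norm.mp hz)) _ _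
  have hterm : ∀ b : ℂ, 1 < ‖b‖ → CircleIntegrable (fun ξ => b⁻¹ * Q b ξ) 0 1 := fun b hb =>
    (hQint b hb).const_fun_smul (a := b⁻¹)
  have hres : ∀ b : ℂ, 1 < ‖b‖ → (∮ ξ in C(0, 1), b⁻¹ * Q b ξ) =
      -(2 * π * I) * (S m (y * b) / b ^ (m + 2)) := fun b hb => by
    have hb0 : b ≠ 0 := norm_pos_iff.mp (one_pos.trans hb)
    rw [circleIntegral.integral_const_mul, circleIntegral_exp_div_pow_mul_sub m y hb]
    field_simp
    ring
  have hpair : ∀ k, CircleIntegrable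
      (fun ξ => (a k)⁻¹ * Q (a k) ξ + (-a k)⁻¹ * Q (-a k) ξ) 0 1 := fun k =>
    (hterm _ (ha1 k)).add (hterm _ (ha1' k))
  have hsplit : (∮ ξ in C(0, 1), (exp (x * ξ) / ξ) ^ (m + 1) * F μ ξ) =
      ∮ ξ in C(0, 1), (exp (y * ξ) * (exp ξ + 1)⁻¹ / ξ ^ (m + 1 + 1) +
        ∑ k ∈ Finset.range (μ + 1),
          ((a k)⁻¹ * Q (a k) ξ + (-a k)⁻¹ * Q (-a k) ξ)) := by
    refine circleIntegral.integral_congr zero_le_one fun z hz => ?_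
    have hexp : (exp (x * z) / z) ^ (m + 1) = exp (y * z) / z ^ (m + 1) := by
      rw [div_pow, ← exp_nat_mul, hy, mul_assoc]
    simp only [hexp, F]
    rw [mul_add, Finset.mul_sum]
    congr 1
    · rw [pow_succ z (m + 1)]
      simp only [div_eq_mul_inv, mul_inv]
      ring
    · refine Finset.sum_congr rfl fun k _ => ?_
      simp only [hQ, ha, sub_neg_eq_add, div_eq_mul_inv, mul_inv]
      ring
  rw [hsplit, circleIntegral.integral_add
    (circleIntegrable_exp_mul_div_pow (fun z hz =>
      differentiableAt_inv_exp_add_one (Metric.sphere_subset_closedBall hz)) _ _)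
    (CircleIntegrable.fun_sum _ fun k _ => hpair k),
    circleIntegral.integral_fun_sum fun k _ => hpair k]
  have hk : ∀ k, (∮ ξ in C(0, 1), ((a k)⁻¹ * Q (a k) ξ + (-a k)⁻¹ * Q (-a k) ξ)) =
      -(2 * π * I) * (S m (y * a k) / a k ^ (m + 2) + S m (-(y * a k)) / (-a k) ^ (m + 2)) := by
    intro k
    rw [circleIntegral.integral_add (hterm _ (ha1 k)) (hterm _ (ha1' k)), hres _ (ha1 k),
      hres _ (ha1' k), mul_neg y, mul_add]
  have hya : ∀ k : ℕ, y * (2 * (k : ℂ) + 1) * π * I = y * a k := fun k => by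
    simp only [ha]; ring
  have hak : ∀ k : ℕ, (2 * (k : ℂ) + 1) * π * I = a k := fun _ => rfl
  simp only [hk, hya, hak, ← Finset.mul_sum, Nat.add_sub_cancel]
  have hcancel : 1 / (π * I) * (π * I) = 1 := one_div_mul_cancel (mul_ne_zero hpi I_ne_zero)
  linear_combination 2 * (∑ k ∈ Finset.range (μ + 1),
    (S m (y * a k) / a k ^ (m + 2) + S m (-(y * a k)) / (-a k) ^ (m + 2))) * hcancel
end

section
/- Let b be a real number with 0 < b < 1/(π e). Then there exists δ₀ > 0 such that for every δ with 0 < δ < δ₀, one has lim_{n→∞} (1/n) · R_n(b, δ) = b, where R_n(b, δ) denotes the number of roots x (counted with multiplicity) of the polynomial x ↦ E_n(n x) satisfying 0 ≤ Re x ≤ b and |Im x| ≤ δ. In particular, the real zeros of E_n(n x) are uniformly distributed in the segment [−1/(πe), 1/(πe)]. -/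
open scoped Real Classical
open Complex

namespace EulerPolynomial

/-- The `n`-th Euler polynomial, written in terms of the Bernoulli polynomial of degree `n + 1`. -/
noncomputable def euler (n : ℕ) : Polynomial ℚ :=
  Polynomial.C (2 ^ (n + 1) / (n + 1 : ℚ)) *
    ((Polynomial.bernoulli (n + 1)).comp (Polynomial.C (1 / 2) * (Polynomial.X + 1)) -
      (Polynomial.bernoulli (n + 1)).comp (Polynomial.C (1 / 2) * Polynomial.X))

theorem aeval_bernoulli_one_add (n : ℕ) (z : ℂ) :
    Polynomial.aeval (1 + z) (Polynomial.bernoulli n) =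
      Polynomial.aeval z (Polynomial.bernoulli n) + n * z ^ (n - 1) := by
  have h := congrArg (Polynomial.aeval z) (Polynomial.bernoulli_comp_one_add_X n)
  simpa [Polynomial.aeval_comp] using h

theorem aeval_euler {A : Type*} [Field A] [CharZero A] [Algebra ℚ A] (n : ℕ) (z : A) :
    Polynomial.aeval z (euler n) = 2 ^ (n + 1) / (n + 1 : A) *
      (Polynomial.aeval ((z + 1) / 2) (Polynomial.bernoulli (n + 1)) -
        Polynomial.aeval (z / 2) (Polynomial.bernoulli (n + 1))) := by
  simp [euler, Polynomial.aeval_comp, div_eq_inv_mul]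

theorem aeval_euler_add_one (n : ℕ) (z : ℂ) :
    Polynomial.aeval (z + 1) (euler n) + Polynomial.aeval z (euler n) = 2 * z ^ n := by
  have h := aeval_bernoulli_one_add (n + 1) (z / 2)
  have hn : (n + 1 : ℂ) ≠ 0 := Nat.cast_add_one_ne_zero n
  rw [aeval_euler, aeval_euler, show (z + 1 + 1) / 2 = 1 + z / 2 by ring, h]
  simp only [Nat.cast_add, Nat.cast_one, Nat.add_sub_cancel, div_pow]
  field_simp
  ring

theorem derivative_euler_succ (n : ℕ) :
    (euler (n + 1)).derivative = Polynomial.C (n + 1 : ℚ) * euler n := by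
  have hn : (n + 1 : ℚ) ≠ 0 := Nat.cast_add_one_ne_zero n
  have hn' : (n + 1 + 1 : ℚ) ≠ 0 := by positivity
  have h1 : (2 ^ (n + 1 + 1) / ((n + 1 : ℕ) + 1 : ℚ)) * (1 / 2) * (n + 1 + 1) =
      (n + 1) * (2 ^ (n + 1) / (n + 1)) := by
    push_cast
    field_simp
    ring
  have h2 := congrArg (Polynomial.C (R := ℚ)) h1
  simp only [Polynomial.C_mul] at h2
  rw [euler, euler, ← mul_assoc, ← h2]
  simp only [Polynomial.derivative_mul, Polynomial.derivative_C, Polynomial.derivative_sub,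
    Polynomial.derivative_comp, Polynomial.derivative_X, Polynomial.derivative_bernoulli_add_one,
    Polynomial.derivative_add, Polynomial.derivative_one, Polynomial.mul_comp,
    Polynomial.add_comp, Polynomial.natCast_comp, Polynomial.one_comp]
  simp only [Polynomial.C_add, map_natCast, map_one]
  push_cast
  ring

theorem eq_of_eval_add_one_add_eval {P Q : Polynomial ℂ}
    (h : ∀ z : ℂ, P.eval (z + 1) + P.eval z = Q.eval (z + 1) + Q.eval z) : P = Q := by
  have hstep (z : ℂ) : (P - Q).eval (z + 1) = -(P - Q).eval z := by
    simp only [Polynomial.eval_sub]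
    linear_combination h z
  have hper (k : ℕ) : (P - Q).eval ((2 * k : ℕ) : ℂ) = (P - Q).eval 0 := by
    induction k with
    | zero => simp
    | succ k ih =>
      rw [← ih, show ((2 * (k + 1) : ℕ) : ℂ) = ((2 * k : ℕ) : ℂ) + 1 + 1 by push_cast; ring,
        hstep, hstep, neg_neg]
  have hconst : P - Q = Polynomial.C ((P - Q).eval 0) := by
    refine Polynomial.eq_of_infinite_eval_eq _ _ ?_
    refine Set.infinite_of_injective_forall_mem (f := fun k : ℕ => ((2 * k : ℕ) : ℂ)) ?_ ?_
    · intro a b hab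
      have : 2 * a = 2 * b := Nat.cast_injective hab
      omega
    · intro k
      simpa using hper k
  have h0 := hstep 0
  rw [hconst] at h0
  simp only [Polynomial.eval_C] at h0
  rw [← sub_eq_zero, hconst, self_eq_neg.mp h0, Polynomial.C_0]

theorem eq_map_euler {n : ℕ} {P : Polynomial ℂ}
    (hP : ∀ z : ℂ, P.eval (z + 1) + P.eval z = 2 * z ^ n) :
    P = (euler n).map (algebraMap ℚ ℂ) := by
  refine eq_of_eval_add_one_add_eval fun z => ?_
  rw [hP, Polynomial.eval_map_algebraMap, Polynomial.eval_map_algebraMap, aeval_euler_add_one]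

/-- The Euler polynomial, normalised to be comparable with `z ↦ sin (π z - n π / 2)`. -/
noncomputable def normalized (n : ℕ) (z : ℂ) : ℂ :=
  π ^ (n + 1) / (4 * n.factorial) * Polynomial.aeval z (euler n)

/-- The difference between the normalised Euler polynomial and its principal part. -/
noncomputable def remainder (n : ℕ) (z : ℂ) : ℂ :=
  normalized n z - sin (π * z - n * π / 2)

theorem hasDerivAt_normalized (n : ℕ) (z : ℂ) :
    HasDerivAt (normalized (n + 1)) (π * normalized n z) z := by
  have h := ((euler (n + 1)).hasDerivAt_aeval z).const_mul
    ((π : ℂ) ^ (n + 1 + 1) / (4 * (n + 1).factorial))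
  refine h.congr_deriv ?_
  have hn : (n + 1 : ℂ) ≠ 0 := Nat.cast_add_one_ne_zero n
  rw [derivative_euler_succ, normalized]
  simp only [map_mul, Polynomial.aeval_C, Nat.factorial_succ]
  push_cast
  field_simp
  ring

theorem hasDerivAt_remainder (n : ℕ) (z : ℂ) :
    HasDerivAt (remainder (n + 1)) (π * remainder n z) z := by
  have h : HasDerivAt (fun z : ℂ => π * z - ((n + 1 : ℕ) : ℂ) * π / 2) π z := by
    simpa using ((hasDerivAt_id z).const_mul (π : ℂ)).sub_const (((n + 1 : ℕ) : ℂ) * π / 2)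
  refine ((hasDerivAt_normalized n z).sub h.csin).congr_deriv ?_
  rw [remainder, show (π : ℂ) * z - ((n + 1 : ℕ) : ℂ) * π / 2 = π * z - n * π / 2 - π / 2 by
    push_cast; ring, cos_sub_pi_div_two]
  ring

theorem remainder_add_one (n : ℕ) (z : ℂ) :
    remainder n (z + 1) = π ^ (n + 1) / (2 * n.factorial) * z ^ n - remainder n z := by
  have h := aeval_euler_add_one n z
  rw [remainder, remainder, normalized, normalized,
    show (π : ℂ) * (z + 1) - n * π / 2 = π * z - n * π / 2 + π by ring, sin_add_pi]
  linear_combination (π : ℂ) ^ (n + 1) / (4 * n.factorial) * h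

theorem sin_sub_natCast_mul_pi_div_two (n : ℕ) (z : ℂ) :
    sin (z - n * π / 2) =
      ((-I) ^ (n + 1) * exp (z * I) + I ^ (n + 1) * exp (-(z * I))) / 2 := by
  have h1 : exp (-(z - n * π / 2) * I) = I ^ n * exp (-(z * I)) := by
    have hI : I ^ n = exp (n * (π / 2 * I)) := by rw [exp_nat_mul, exp_pi_div_two_mul_I]
    rw [hI, ← exp_add]
    congr 1
    ring
  have h2 : exp ((z - n * π / 2) * I) = (-I) ^ n * exp (z * I) := by
    have hI : (-I) ^ n = exp (n * (-π / 2 * I)) := by rw [exp_nat_mul, exp_neg_pi_div_two_mul_I]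
    rw [hI, ← exp_add]
    congr 1
    ring
  rw [Complex.sin, h1, h2]
  ring

theorem hasSum_normalized {n : ℕ} (hn : 1 ≤ n) {x : ℝ} (hx : x ∈ Set.Icc (0 : ℝ) 1) :
    HasSum (fun m : ℤ => -((-I) ^ (n + 1) / 4) *
      (1 / (m : ℂ) ^ (n + 1) * (exp (m * (π * I)) - 1) * exp (m * (π * x * I))))
      (normalized n x) := by
  have h1 := hasSum_one_div_pow_mul_fourier_mul_bernoulliFun (k := n + 1) (by omega)
    (x := (x + 1) / 2) ⟨by linarith [hx.1], by linarith [hx.2]⟩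
  have h0 := hasSum_one_div_pow_mul_fourier_mul_bernoulliFun (k := n + 1) (by omega)
    (x := x / 2) ⟨by linarith [hx.1], by linarith [hx.2]⟩
  have h := (h1.sub h0).mul_left (-((-I) ^ (n + 1) / 4))
  have hB (y : ℝ) : (bernoulliFun (n + 1) y : ℂ) =
      Polynomial.aeval (y : ℂ) (Polynomial.bernoulli (n + 1)) := by
    rw [bernoulliFun, Polynomial.eval_map_algebraMap]
    exact (Polynomial.aeval_algebraMap_apply ℂ y _).symm
  convert! h using 1
  · ext m
    rw [fourier_coe_apply, fourier_coe_apply, mul_assoc (1 / (m : ℂ) ^ (n + 1)), sub_mul, one_mul,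
      ← exp_add, ← mul_sub]
    congr 4
    · push_cast
      ring_nf
    · push_cast
      ring_nf
  · have hI : (-I) ^ (n + 1) * I ^ (n + 1) = 1 := by rw [← mul_pow]; simp
    have hn' : (n + 1 : ℂ) ≠ 0 := Nat.cast_add_one_ne_zero n
    have hf : (n.factorial : ℂ) ≠ 0 := Nat.cast_ne_zero.mpr n.factorial_ne_zero
    rw [normalized, aeval_euler, hB, hB, Nat.factorial_succ]
    push_cast
    simp only [mul_pow, neg_mul]
    field_simp
    linear_combination
      (Polynomial.aeval ((x : ℂ) / 2) (Polynomial.bernoulli (n + 1)) -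
        Polynomial.aeval (((x : ℂ) + 1) / 2) (Polynomial.bernoulli (n + 1))) * hI

theorem exists_norm_remainder_ofReal_le :
    ∃ C : ℝ, 0 < C ∧ ∀ (n : ℕ) (x : ℝ), x ∈ Set.Icc (0 : ℝ) 1 →
      ‖remainder n x‖ ≤ C * (1 / 2) ^ n := by
  have hs : Summable fun m : ℤ => 1 / (m : ℝ) ^ 2 :=
    Real.summable_one_div_int_pow.mpr one_lt_two
  set S := ∑' m : ℤ, 1 / (m : ℝ) ^ 2 with hS
  have hS0 : 0 ≤ S := tsum_nonneg fun m => by positivity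
  refine ⟨2 + S, by positivity, fun n x hx => ?_⟩
  rcases Nat.eq_zero_or_pos n with rfl | hn
  · have h1 : ‖sin ((π * x : ℝ) : ℂ)‖ ≤ 1 := by
      rw [← ofReal_sin, norm_real]
      exact Real.abs_sin_le_one _
    have h2 : ‖normalized 0 (x : ℂ)‖ ≤ 1 := by
      have he : normalized 0 (x : ℂ) = ((π / 4 : ℝ) : ℂ) := by
        rw [normalized, aeval_euler]
        simp [Polynomial.bernoulli_one]
        ring
      rw [he, norm_real, Real.norm_eq_abs, abs_of_pos (by positivity)]
      linarith [Real.pi_lt_four]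
    calc ‖remainder 0 x‖ ≤ ‖normalized 0 (x : ℂ)‖ + ‖sin ((π * x : ℝ) : ℂ)‖ := by
          rw [remainder]
          refine (norm_sub_le _ _).trans_eq ?_
          simp
      _ ≤ (2 + S) * (1 / 2) ^ 0 := by linarith
  · set a : ℤ → ℂ := fun m => -((-I) ^ (n + 1) / 4) *
      (1 / (m : ℂ) ^ (n + 1) * (exp (m * (π * I)) - 1) * exp (m * (π * x * I))) with ha
    have hsum : HasSum a (normalized n x) := hasSum_normalized hn hx
    have hfin : HasSum (fun m => if m ∈ ({-1, 1} : Finset ℤ) then a m else 0)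
        (∑ m ∈ ({-1, 1} : Finset ℤ), a m) := by
      rw [← Finset.sum_congr rfl fun m hm => if_pos hm]
      exact hasSum_sum_of_ne_finset_zero fun m hm => if_neg hm
    have hmain : ∑ m ∈ ({-1, 1} : Finset ℤ), a m = sin (π * x - n * π / 2) := by
      have hI : (-I) ^ (n + 1) * (-1) ^ (n + 1) = I ^ (n + 1) := by rw [← mul_pow]; simp
      rw [Finset.sum_pair (by norm_num), sin_sub_natCast_mul_pi_div_two, ha]
      simp only [Int.cast_neg, Int.cast_one, one_mul, exp_pi_mul_I, neg_mul, exp_neg,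
        one_div, ← inv_pow]
      rw [← hI]
      norm_num
      ring
    have hdiff := hsum.sub hfin
    rw [hmain] at hdiff
    refine (hdiff.norm_le_of_bounded ((hs.hasSum).mul_left ((1 / 2 : ℝ) ^ n)) fun m => ?_).trans ?_
    · split_ifs with hm
      · rw [sub_self, norm_zero]
        positivity
      · rw [sub_zero, ha]
        have he1 : ‖exp (m * (π * I)) - 1‖ ≤ 2 := by
          refine (norm_sub_le _ _).trans ?_
          rw [show (m : ℂ) * (π * I) = ((m * π : ℝ) : ℂ) * I by push_cast; ring,
            norm_exp_ofReal_mul_I, norm_one]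
          norm_num
        have he2 : ‖exp (m * (π * x * I))‖ = 1 := by
          rw [show (m : ℂ) * (π * x * I) = ((m * π * x : ℝ) : ℂ) * I by push_cast; ring,
            norm_exp_ofReal_mul_I]
        simp only [norm_mul, norm_neg, norm_div, norm_pow, norm_I, one_pow, he2, mul_one, norm_one]
        rcases eq_or_ne m 0 with rfl | hm0
        · simp
        have hm2 : (2 : ℝ) ≤ ‖(m : ℂ)‖ := by
          rw [norm_intCast]
          simp only [Finset.mem_insert, Finset.mem_singleton, not_or] at hm
          have : 2 ≤ |m| := by
            rcases abs_cases m with h | h <;> omega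
          exact_mod_cast this
        have hsq : (m : ℝ) ^ 2 = ‖(m : ℂ)‖ ^ 2 := by rw [norm_intCast, sq_abs]
        rw [hsq]
        set r := ‖(m : ℂ)‖
        have hp : (2 : ℝ) ^ (n - 1) ≤ r ^ (n - 1) := pow_le_pow_left₀ (by norm_num) hm2 _
        obtain ⟨j, rfl⟩ : ∃ j, n = j + 1 := ⟨n - 1, by omega⟩
        simp only [Nat.add_sub_cancel] at hp
        have hr : 0 < r := by linarith
        calc 1 / ‖(4 : ℂ)‖ * (1 / r ^ (j + 1 + 1) * ‖exp (m * (π * I)) - 1‖)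
            ≤ 1 / 4 * (1 / r ^ (j + 1 + 1) * 2) := by
              rw [show ‖(4 : ℂ)‖ = 4 by norm_num]
              gcongr
          _ = (1 / 2) * (1 / r ^ 2) * (1 / r ^ j) := by
              field_simp
              ring
          _ ≤ (1 / 2) * (1 / r ^ 2) * (1 / 2 ^ j) := by gcongr
          _ = (1 / 2) ^ (j + 1) * (1 / r ^ 2) := by
              rw [one_div_pow]
              field_simp
              ring
    · have : (0 : ℝ) < (1 / 2) ^ n := by positivity
      nlinarith

theorem norm_sin_le_exp_abs_im (z : ℂ) : ‖sin z‖ ≤ Real.exp |z.im| := by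
  have h1 : ‖exp (-z * I)‖ ≤ Real.exp |z.im| := by
    rw [norm_exp]
    simpa using le_abs_self z.im
  have h2 : ‖exp (z * I)‖ ≤ Real.exp |z.im| := by
    rw [norm_exp]
    simpa using neg_le_abs z.im
  rw [Complex.sin, norm_div, norm_mul, norm_I, mul_one]
  have h3 := norm_sub_le (exp (-z * I)) (exp (z * I))
  rw [show ‖(2 : ℂ)‖ = 2 by norm_num]
  linarith

theorem norm_remainder_vertical_le {C : ℝ} (hC : 2 ≤ C)
    (hreal : ∀ (n : ℕ) (x : ℝ), x ∈ Set.Icc (0 : ℝ) 1 → ‖remainder n x‖ ≤ C * (1 / 2) ^ n)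
    {x : ℝ} (hx : x ∈ Set.Icc (0 : ℝ) 1) {s : ℝ} (hs : |s| = 1) (n : ℕ) {t : ℝ} (ht : 0 ≤ t) :
    ‖remainder n (x + s * t * I)‖ ≤ C * (1 / 2) ^ n * Real.exp (2 * π * t) := by
  induction n generalizing t with
  | zero =>
    have h0 : normalized 0 ((x : ℂ) + s * t * I) = ((π / 4 : ℝ) : ℂ) := by
      rw [normalized, aeval_euler]
      simp [Polynomial.bernoulli_one]
      ring
    have h1 : ‖((π / 4 : ℝ) : ℂ)‖ ≤ 1 := by
      rw [norm_real, Real.norm_eq_abs, abs_of_pos (by positivity)]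
      linarith [Real.pi_lt_four]
    have h2 := norm_sin_le_exp_abs_im (π * (x + s * t * I) - (0 : ℕ) * π / 2)
    have him : |((π : ℂ) * (x + s * t * I) - (0 : ℕ) * π / 2).im| = π * t := by
      have : ((π : ℂ) * (x + s * t * I) - (0 : ℕ) * π / 2).im = π * (s * t) := by simp
      rw [this, abs_mul, abs_mul, hs, abs_of_pos Real.pi_pos, abs_of_nonneg ht, one_mul]
    rw [him] at h2
    have h3 : Real.exp (π * t) ≤ Real.exp (2 * π * t) := by
      apply Real.exp_le_exp.mpr
      nlinarith [Real.pi_pos]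
    have h4 : 1 ≤ Real.exp (2 * π * t) := Real.one_le_exp (by positivity)
    rw [remainder, h0, pow_zero, mul_one]
    refine (norm_sub_le _ _).trans ?_
    nlinarith
  | succ n ih =>
    have hline (t : ℝ) : HasDerivAt (fun t : ℝ => (x : ℂ) + s * t * I) (s * I) t := by
      have h := ((hasDerivAt_id t).ofReal_comp.const_mul (s : ℂ)).mul_const I
      simpa using h.const_add (x : ℂ)
    have hf (t : ℝ) : HasDerivAt (fun t : ℝ => remainder (n + 1) (x + s * t * I))
        (π * remainder n (x + s * t * I) * (s * I)) t :=
      (hasDerivAt_remainder n _).comp t (hline t)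
    have hB (t : ℝ) : HasDerivAt (fun t : ℝ => C * (1 / 2) ^ (n + 1) * Real.exp (2 * π * t))
        (C * (1 / 2) ^ (n + 1) * (Real.exp (2 * π * t) * (2 * π))) t := by
      have h := ((hasDerivAt_id t).const_mul (2 * π)).exp.const_mul (C * (1 / 2) ^ (n + 1))
      simpa using h
    refine image_norm_le_of_norm_deriv_right_le_deriv_boundary (a := 0) (b := t)
      (fun u _ => (hf u).continuousAt.continuousWithinAt) (fun u _ => (hf u).hasDerivWithinAt)
      ?_ hB (fun u hu => ?_) ⟨ht, le_rfl⟩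
    · simpa using hreal (n + 1) x hx
    · have h := ih hu.1
      simp only [norm_mul, norm_I, norm_real, Real.norm_eq_abs, hs, mul_one,
        abs_of_pos Real.pi_pos]
      calc π * ‖remainder n (x + s * u * I)‖ ≤
          π * (C * (1 / 2) ^ n * Real.exp (2 * π * u)) := by gcongr
        _ = C * (1 / 2) ^ (n + 1) * (Real.exp (2 * π * u) * (2 * π)) := by ring

theorem exists_norm_remainder_le :
    ∃ C : ℝ, ∀ (n : ℕ) (z : ℂ), 0 ≤ z.re → z.re ≤ 1 →
      ‖remainder n z‖ ≤ C * (1 / 2) ^ n * Real.exp (2 * π * |z.im|) := by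
  obtain ⟨C, hC, h⟩ := exists_norm_remainder_ofReal_le
  refine ⟨C + 2, fun n z h0 h1 => ?_⟩
  have hreal : ∀ (n : ℕ) (x : ℝ), x ∈ Set.Icc (0 : ℝ) 1 →
      ‖remainder n x‖ ≤ (C + 2) * (1 / 2) ^ n := fun n x hx =>
    (h n x hx).trans (by gcongr; linarith)
  rcases le_total 0 z.im with hz | hz
  · have := norm_remainder_vertical_le (by linarith) hreal ⟨h0, h1⟩ (s := 1) (by simp) n hz
    rw [abs_of_nonneg hz]
    simpa [re_add_im] using this
  · have := norm_remainder_vertical_le (by linarith) hreal ⟨h0, h1⟩ (s := -1) (by simp) n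
      (neg_nonneg.mpr hz)
    rw [abs_of_nonpos hz]
    simpa [re_add_im] using this

theorem norm_remainder_add_natCast_le (n m : ℕ) {w : ℂ} {R : ℝ} (hw : 0 ≤ w.re)
    (hR : w.re + m + |w.im| ≤ R) :
    ‖remainder n (w + m)‖ ≤ ‖remainder n w‖ + m * (π ^ (n + 1) / (2 * n.factorial) * R ^ n) := by
  induction m with
  | zero => simp
  | succ m ih =>
    push_cast at hR ⊢
    have hnorm : ‖w + m‖ ≤ R := by
      have h := norm_le_abs_re_add_abs_im (w + m)
      have hre : (w + m).re = w.re + m := by simp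
      have him : (w + m).im = w.im := by simp
      rw [hre, him, abs_of_nonneg (by positivity)] at h
      linarith
    have hc : ‖(π : ℂ) ^ (n + 1) / (2 * n.factorial)‖ = π ^ (n + 1) / (2 * n.factorial) := by
      simp [abs_of_pos Real.pi_pos]
    rw [← add_assoc, remainder_add_one]
    calc _ ≤ ‖(π : ℂ) ^ (n + 1) / (2 * n.factorial) * (w + m) ^ n‖ + ‖remainder n (w + m)‖ :=
          norm_sub_le _ _
      _ ≤ π ^ (n + 1) / (2 * n.factorial) * R ^ n +
          (‖remainder n w‖ + m * (π ^ (n + 1) / (2 * n.factorial) * R ^ n)) := by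
        rw [norm_mul, hc, norm_pow]
        gcongr
        exact ih (by linarith)
      _ = _ := by ring

theorem pow_self_mul_div_factorial_le {a : ℝ} (ha : 0 ≤ a) (n : ℕ) :
    (a * (n + 1)) ^ (n + 1) / n.factorial ≤ (n + 1) * (a * Real.exp 1) ^ (n + 1) := by
  have h := Real.pow_div_factorial_le_exp (x := n + 1) (by positivity) (n + 1)
  rw [Nat.factorial_succ] at h
  push_cast at h
  have he : Real.exp ((n : ℝ) + 1) = Real.exp 1 ^ (n + 1) := by
    rw [← Real.exp_nat_mul]
    simp
  rw [he] at h
  calc (a * (n + 1)) ^ (n + 1) / n.factorial =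
      (n + 1) * (a ^ (n + 1) * (((n : ℝ) + 1) ^ (n + 1) / ((n + 1) * n.factorial))) := by
        rw [mul_pow]
        field_simp
    _ ≤ (n + 1) * (a ^ (n + 1) * Real.exp 1 ^ (n + 1)) := by gcongr
    _ = _ := by rw [mul_pow]

theorem exists_strip_eventually_norm_remainder_le {b : ℝ} (hb₀ : 0 < b)
    (hb : b < 1 / (π * Real.exp 1)) :
    ∃ δ : ℝ, 0 < δ ∧ ∀ ε : ℝ, 0 < ε → ∀ᶠ n : ℕ in Filter.atTop, ∀ z : ℂ,
      0 ≤ z.re → z.re ≤ (n + 1) * b → |z.im| ≤ (n + 1) * δ → ‖remainder n z‖ ≤ ε := by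
  obtain ⟨C, hC⟩ := exists_norm_remainder_le
  have hpe : 0 < π * Real.exp 1 := by positivity
  set δ : ℝ := min ((1 / (π * Real.exp 1) - b) / 2) (1 / 20) with hδ
  have hδ0 : 0 < δ := lt_min (by linarith) (by norm_num)
  have hδ1 : b + δ < 1 / (π * Real.exp 1) := by
    have := min_le_left ((1 / (π * Real.exp 1) - b) / 2) (1 / 20)
    linarith
  have hδ2 : δ ≤ 1 / 20 := min_le_right _ _
  refine ⟨δ, hδ0, fun ε hε => ?_⟩
  set q : ℝ := π * (b + δ) * Real.exp 1 with hq
  have hq0 : 0 ≤ q := by positivity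
  have hq1 : q < 1 := by
    rw [lt_div_iff₀ hpe] at hδ1
    linarith
  set r : ℝ := Real.exp (2 * π * δ) / 2 with hr
  have hr0 : 0 ≤ r := by positivity
  have hr1 : r < 1 := by
    rw [hr, div_lt_one two_pos, ← Real.lt_log_iff_exp_lt two_pos]
    have := Real.log_two_gt_d9
    nlinarith [Real.pi_lt_d2, Real.pi_pos]
  have hlim : Filter.Tendsto (fun n : ℕ => 2 * |C| * r ^ n + 1 / 2 * (n * q ^ n))
      Filter.atTop (nhds 0) := by
    have h := ((tendsto_pow_atTop_nhds_zero_of_lt_one hr0 hr1).const_mul (2 * |C|)).add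
      ((tendsto_self_mul_const_pow_of_lt_one hq0 hq1).const_mul (1 / 2))
    rwa [mul_zero, mul_zero, add_zero] at h
  filter_upwards [((Filter.tendsto_add_atTop_iff_nat 1).mpr hlim).eventually_le_const hε]
    with n hn z h0 h1 h2
  refine le_trans ?_ hn
  set m := ⌊z.re⌋₊ with hm
  have hm0 : (m : ℝ) ≤ z.re := Nat.floor_le h0
  have hm1 : z.re < m + 1 := Nat.lt_floor_add_one _
  set R : ℝ := (n + 1) * (b + δ) with hR
  have hzR : z.re + |z.im| ≤ R := by
    rw [hR]
    linarith
  have hmR : (m : ℝ) ≤ R := by linarith [abs_nonneg z.im]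
  have h := norm_remainder_add_natCast_le n m (w := z - m) (R := R) (by simpa using hm0)
    (by simpa using hzR)
  rw [sub_add_cancel] at h
  have hw := hC n (z - m) (by simpa using hm0) (by simp; linarith)
  have him : (z - m).im = z.im := by simp
  rw [him] at hw
  have hA : C * (1 / 2) ^ n * Real.exp (2 * π * |z.im|) ≤ 2 * |C| * r ^ (n + 1) := by
    calc C * (1 / 2) ^ n * Real.exp (2 * π * |z.im|)
        ≤ |C| * (1 / 2) ^ n * Real.exp (2 * π * ((n + 1) * δ)) := by
          gcongr
          exact le_abs_self C
      _ = 2 * |C| * r ^ (n + 1) := by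
          have he : Real.exp (2 * π * ((n + 1) * δ)) = Real.exp (2 * π * δ) ^ (n + 1) := by
            rw [← Real.exp_nat_mul]
            push_cast
            ring_nf
          rw [hr, he, div_pow (Real.exp _), one_div_pow]
          field_simp
          ring
  have hB : m * (π ^ (n + 1) / (2 * n.factorial) * R ^ n) ≤
      1 / 2 * (((n + 1 : ℕ) : ℝ) * q ^ (n + 1)) := by
    have hRpos : 0 ≤ R := by positivity
    calc m * (π ^ (n + 1) / (2 * n.factorial) * R ^ n)
        ≤ R * (π ^ (n + 1) / (2 * n.factorial) * R ^ n) := by gcongr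
      _ = 1 / 2 * ((π * (b + δ) * (n + 1)) ^ (n + 1) / n.factorial) := by
          rw [show π * (b + δ) * (n + 1) = π * R by rw [hR]; ring, mul_pow π R]
          field_simp
          ring
      _ ≤ 1 / 2 * (((n + 1 : ℕ) : ℝ) * q ^ (n + 1)) := by
          push_cast
          gcongr
          exact pow_self_mul_div_factorial_le (by positivity) n
  linarith

theorem sin_add_intCast_mul_pi (z : ℂ) (j : ℤ) : sin (z + j * π) = (-1) ^ j * sin z :=
  j.cast_negOnePow ℂ ▸ sin_antiperiodic.add_int_mul_eq j

theorem re_sin (z : ℂ) : (sin z).re = Real.sin z.re * Real.cosh z.im := by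
  rw [sin_eq, ← ofReal_sin, ← ofReal_cosh, ← ofReal_cos, ← ofReal_sinh, ← ofReal_mul, ← ofReal_mul,
    add_re, ofReal_re, re_ofReal_mul, I_re, mul_zero, add_zero]

theorem re_cos (z : ℂ) : (cos z).re = Real.cos z.re * Real.cosh z.im := by
  rw [cos_eq, ← ofReal_sin, ← ofReal_cosh, ← ofReal_cos, ← ofReal_sinh, ← ofReal_mul, ← ofReal_mul,
    sub_re, ofReal_re, re_ofReal_mul, I_re, mul_zero, sub_zero]

theorem sin_pi_mul_sub_natCast_mul_pi_div_two (n : ℕ) (j : ℤ) (z : ℂ) :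
    sin (π * z - n * π / 2) = (-1) ^ j * sin (π * (z - n / 2 - j)) := by
  rw [← sin_add_intCast_mul_pi]
  congr 1
  ring

theorem abs_le_quarter_of_abs_sin_pi_mul_le {x : ℝ} (hx : |x| ≤ 1 / 2)
    (h : |Real.sin (π * x)| ≤ 1 / 2) :
    |x| ≤ 1 / 4 := by
  by_contra! hlt
  have h1 : Real.sin (π / 4) < Real.sin (π * |x|) := by
    apply Real.sin_lt_sin_of_lt_of_le_pi_div_two <;> nlinarith [Real.pi_pos]
  have h2 : Real.sin (π * |x|) ≤ 1 / 2 := by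
    rcases abs_cases x with ⟨he, -⟩ | ⟨he, -⟩
    · rw [he]
      exact (le_abs_self _).trans h
    · rw [he, mul_neg, Real.sin_neg]
      exact (neg_le_abs _).trans h
  rw [Real.sin_pi_div_four] at h1
  have h3 : (1 : ℝ) < √2 := Real.lt_sqrt_of_sq_lt (by norm_num)
  linarith

theorem half_lt_re_cos {z : ℂ} (hz : |z.re| ≤ 1 / 4) : 1 / 2 < (cos (π * z)).re := by
  have hre : (cos (π * z)).re = Real.cos (π * z.re) * Real.cosh (π * z.im) := by
    rw [re_cos, re_ofReal_mul, im_ofReal_mul]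
  have h1 : Real.cos (π / 4) ≤ Real.cos (π * z.re) := by
    rw [← Real.cos_abs (π * z.re), abs_mul, abs_of_pos Real.pi_pos]
    apply Real.cos_le_cos_of_nonneg_of_le_pi <;> nlinarith [Real.pi_pos, abs_nonneg z.re]
  have h2 := Real.one_le_cosh (π * z.im)
  rw [Real.cos_pi_div_four] at h1
  have h3 : (1 : ℝ) < √2 := Real.lt_sqrt_of_sq_lt (by norm_num)
  rw [hre]
  nlinarith

theorem abs_sub_round_le_of_normalized_eq_zero {n : ℕ} {z : ℂ} (hz : normalized n z = 0)
    (hr : ‖remainder n z‖ ≤ 1 / 2) : |z.re - n / 2 - round (z.re - n / 2)| ≤ 1 / 4 := by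
  set j := round (z.re - n / 2) with hj
  refine abs_le_quarter_of_abs_sin_pi_mul_le (abs_sub_round _) ?_
  rw [remainder, hz, zero_sub, norm_neg, sin_pi_mul_sub_natCast_mul_pi_div_two n j, norm_mul,
    norm_zpow, norm_neg, norm_one, one_zpow, one_mul] at hr
  refine le_trans ?_ hr
  refine le_trans ?_ (abs_re_le_norm _)
  have hre : (sin (π * (z - n / 2 - j))).re =
      Real.sin (π * (z.re - n / 2 - j)) * Real.cosh (π * z.im) := by
    rw [re_sin, re_ofReal_mul, im_ofReal_mul]
    simp
  rw [hre, abs_mul]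
  have h2 := Real.one_le_cosh (π * z.im)
  exact le_mul_of_one_le_right (abs_nonneg _) (h2.trans (le_abs_self _))

theorem re_neg_one_zpow_mul_normalized_pos {n : ℕ} {z : ℂ} {j : ℤ}
    (hr : ‖remainder n z‖ ≤ 1 / 2) (hj : |z.re - (n + 1) / 2 - j| ≤ 1 / 4) :
    0 < ((-1) ^ j * normalized n z).re := by
  have hcos : sin (π * z - n * π / 2) = (-1) ^ j * cos (π * (z - (n + 1) / 2 - j)) := by
    rw [show (π : ℂ) * z - n * π / 2 = π * (z - (n + 1) / 2 - j) + π / 2 + j * π by ring,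
      sin_add_intCast_mul_pi, sin_add_pi_div_two]
  have hsq : ((-1 : ℂ) ^ j) * (-1) ^ j = 1 := by rw [← mul_zpow]; simp
  have h1 : (-1) ^ j * normalized n z =
      (-1) ^ j * remainder n z + cos (π * (z - (n + 1) / 2 - j)) := by
    rw [remainder, hcos]
    linear_combination cos (π * (z - (n + 1) / 2 - j)) * hsq
  have h2 : 1 / 2 < (cos (π * (z - (n + 1) / 2 - j))).re :=
    half_lt_re_cos (by simpa using hj)
  have h3 : ‖(-1) ^ j * remainder n z‖ ≤ 1 / 2 := by
    rwa [norm_mul, norm_zpow, norm_neg, norm_one, one_zpow, one_mul]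
  have h4 := (abs_le.mp ((abs_re_le_norm _).trans h3)).1
  rw [h1, add_re]
  linarith

theorem normalized_injOn {n : ℕ} {s : Set ℂ} (hs : Convex ℝ s)
    (hr : ∀ z ∈ s, ‖remainder n z‖ ≤ 1 / 2) {j : ℤ}
    (hj : ∀ z ∈ s, |z.re - (n + 1) / 2 - j| ≤ 1 / 4) :
    Set.InjOn (normalized (n + 1)) s := by
  intro z hz w hw hzw
  by_contra hne
  set v := w - z with hv
  have hv0 : v ≠ 0 := sub_ne_zero.mpr (Ne.symm hne)
  have hline (t : ℝ) : HasDerivAt (fun t : ℝ => z + t * v) v t := by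
    have h := (hasDerivAt_id t).ofReal_comp.mul_const v
    simpa using h.const_add z
  have hd (t : ℝ) : HasDerivAt (fun t : ℝ => normalized (n + 1) (z + t * v))
      (π * normalized n (z + t * v) * v) t :=
    (hasDerivAt_normalized n _).comp t (hline t)
  have hg (t : ℝ) : HasDerivAt
      (fun t : ℝ => (starRingEnd ℂ v * (-1) ^ j * normalized (n + 1) (z + t * v)).re)
      (starRingEnd ℂ v * (-1) ^ j * (π * normalized n (z + t * v) * v)).re t :=
    reCLM.hasFDerivAt.comp_hasDerivAt t ((hd t).const_mul (starRingEnd ℂ v * (-1) ^ j))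
  obtain ⟨t, ht, h0⟩ := exists_hasDerivAt_eq_zero (a := 0) (b := 1) one_pos
    (fun t _ => (hg t).continuousAt.continuousWithinAt) (by simp [hv, hzw]) (fun t _ => hg t)
  have hmem : z + t * v ∈ s := by
    have h := hs.add_smul_sub_mem hz hw ⟨ht.1.le, ht.2.le⟩
    simpa [hv] using h
  have hpos := re_neg_one_zpow_mul_normalized_pos (hr _ hmem) (hj _ hmem)
  have he : starRingEnd ℂ v * (-1) ^ j * (π * normalized n (z + t * v) * v) =
      ((π * normSq v : ℝ) : ℂ) * ((-1) ^ j * normalized n (z + t * v)) := by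
    push_cast
    rw [normSq_eq_conj_mul_self]
    ring
  rw [he, re_ofReal_mul] at h0
  have : 0 < π * normSq v := mul_pos Real.pi_pos (normSq_pos.mpr hv0)
  nlinarith [mul_pos this hpos]

theorem exists_normalized_eq_zero {n : ℕ} {j : ℤ}
    (hr : ∀ x : ℝ, |x - n / 2 - j| ≤ 1 / 4 → ‖remainder n x‖ ≤ 1 / 2) :
    ∃ x : ℝ, |x - n / 2 - j| ≤ 1 / 4 ∧ normalized n x = 0 := by
  set g : ℝ → ℝ := fun x =>
    (-1) ^ j * (π ^ (n + 1) / (4 * n.factorial) * Polynomial.aeval x (euler n)) with hg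
  have hgc : Continuous g := by fun_prop
  have hgn (x : ℝ) : (g x : ℂ) = (-1) ^ j * normalized n x := by
    have h : Polynomial.aeval (x : ℂ) (euler n) = ((Polynomial.aeval x (euler n) : ℝ) : ℂ) :=
      Polynomial.aeval_algebraMap_apply ℂ x _
    rw [normalized, h, hg]
    push_cast
    ring
  have hsq : ((-1 : ℂ) ^ j) * (-1) ^ j = 1 := by rw [← mul_zpow]; simp
  have hclose (x : ℝ) (hx : |x - n / 2 - j| ≤ 1 / 4) :
      |g x - Real.sin (π * (x - n / 2 - j))| ≤ 1 / 2 := by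
    have h := hr x hx
    have he : ((g x - Real.sin (π * (x - n / 2 - j)) : ℝ) : ℂ) = (-1) ^ j * remainder n x := by
      rw [ofReal_sub, hgn, remainder, sin_pi_mul_sub_natCast_mul_pi_div_two n j]
      push_cast
      linear_combination sin (π * ((x : ℂ) - n / 2 - j)) * hsq
    rw [← Real.norm_eq_abs, ← norm_real, he, norm_mul, norm_zpow, norm_neg, norm_one, one_zpow,
      one_mul]
    exact h
  have h3 : (1 : ℝ) < √2 := Real.lt_sqrt_of_sq_lt (by norm_num)
  have hneg : g (n / 2 + j - 1 / 4) ≤ 0 := by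
    have h := hclose (n / 2 + j - 1 / 4) (by ring_nf; norm_num [abs_le])
    rw [show π * ((n : ℝ) / 2 + j - 1 / 4 - n / 2 - j) = -(π / 4) by ring, Real.sin_neg,
      Real.sin_pi_div_four] at h
    linarith [(abs_le.mp h).2]
  have hpos : 0 ≤ g (n / 2 + j + 1 / 4) := by
    have h := hclose (n / 2 + j + 1 / 4) (by ring_nf; norm_num [abs_le])
    rw [show π * ((n : ℝ) / 2 + j + 1 / 4 - n / 2 - j) = π / 4 by ring,
      Real.sin_pi_div_four] at h
    linarith [(abs_le.mp h).1]
  obtain ⟨x, hx, hx0⟩ := intermediate_value_Icc (by linarith) hgc.continuousOn ⟨hneg, hpos⟩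
  refine ⟨x, abs_le.mpr ⟨by linarith [hx.1], by linarith [hx.2]⟩, ?_⟩
  have h := hgn x
  rw [hx0, ofReal_zero] at h
  linear_combination (-normalized n x) * hsq - (-1) ^ j * h

/-- If the remainder is at most `1 / 2` on a rectangle of length `X`, the Euler polynomial has
`X + O(1)` roots there, counted with multiplicity. -/
theorem abs_card_roots_sub_le {n : ℕ} {X Y : ℝ} (hX : 0 ≤ X) (hY : 0 ≤ Y)
    (hr : ∀ z : ℂ, 0 ≤ z.re → z.re ≤ X → |z.im| ≤ Y → ‖remainder n z‖ ≤ 1 / 2)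
    (hr' : ∀ z : ℂ, 0 ≤ z.re → z.re ≤ X → |z.im| ≤ Y → ‖remainder (n + 1) z‖ ≤ 1 / 2)
    {a : ℝ} (ha : 0 < a) {p : Polynomial ℂ}
    (hp : p = ((euler (n + 1)).map (algebraMap ℚ ℂ)).comp (Polynomial.C (a : ℂ) * Polynomial.X)) :
    |((p.roots.filter
      (fun x => 0 ≤ a * x.re ∧ a * x.re ≤ X ∧ |a * x.im| ≤ Y)).card : ℝ) - X| ≤ 3 := by
  have hconst (m : ℕ) : (π : ℂ) ^ (m + 1) / (4 * m.factorial) ≠ 0 := by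
    have : (π : ℂ) ≠ 0 := ofReal_ne_zero.mpr Real.pi_ne_zero
    have : (m.factorial : ℂ) ≠ 0 := Nat.cast_ne_zero.mpr m.factorial_ne_zero
    simp_all
  have ha' : (a : ℂ) ≠ 0 := ofReal_ne_zero.mpr ha.ne'
  have heval (x : ℂ) : p.eval x = Polynomial.aeval (a * x) (euler (n + 1)) := by
    rw [hp, Polynomial.eval_comp, Polynomial.eval_map_algebraMap]
    simp
  have hroot (x : ℂ) : p.IsRoot x ↔ normalized (n + 1) (a * x) = 0 := by
    rw [Polynomial.IsRoot, heval, normalized, mul_eq_zero, or_iff_right (hconst _)]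
  have hp0 : p ≠ 0 := by
    intro h
    have h1 := aeval_euler_add_one (n + 1) 1
    have h2 := heval ((1 + 1) / a)
    have h3 := heval (1 / a)
    rw [h, Polynomial.eval_zero, mul_div_cancel₀ _ ha'] at h2 h3
    rw [← h2, ← h3] at h1
    norm_num at h1
  have hder (x : ℂ) (hx : p.derivative.IsRoot x) : normalized n (a * x) = 0 := by
    rw [Polynomial.IsRoot, hp, Polynomial.derivative_comp, Polynomial.derivative_map,
      derivative_euler_succ] at hx
    have hn : (n + 1 : ℂ) ≠ 0 := Nat.cast_add_one_ne_zero n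
    simp [ha', hn, Polynomial.eval_comp, Polynomial.eval_map_algebraMap] at hx
    rw [normalized, hx, mul_zero]
  set s := p.roots.filter (fun x => 0 ≤ a * x.re ∧ a * x.re ≤ X ∧ |a * x.im| ≤ Y) with hs
  have hmem (x : ℂ) : x ∈ s ↔ normalized (n + 1) (a * x) = 0 ∧
      0 ≤ (a * x).re ∧ (a * x).re ≤ X ∧ |(a * x).im| ≤ Y := by
    rw [hs, Multiset.mem_filter, Polynomial.mem_roots hp0, hroot, re_ofReal_mul, im_ofReal_mul]
  set φ : ℂ → ℤ := fun x => round ((a * x).re - ((n + 1 : ℕ) : ℝ) / 2) with hφ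
  have hφs (x : ℂ) (hx : x ∈ s) : |(a * x).re - (n + 1) / 2 - φ x| ≤ 1 / 4 := by
    obtain ⟨h0, h1, h2, h3⟩ := (hmem x).mp hx
    have h := abs_sub_round_le_of_normalized_eq_zero h0 (hr' _ h1 h2 h3)
    rw [hφ]
    push_cast at h ⊢
    exact h
  have hnodup : s.Nodup := by
    rw [Multiset.nodup_iff_count_le_one]
    intro x
    by_cases hx : x ∈ s
    · refine (Multiset.count_le_of_le x (Multiset.filter_le _ _)).trans ?_
      rw [Polynomial.count_roots]
      by_contra! hlt
      have h := ((Polynomial.one_lt_rootMultiplicity_iff_isRoot hp0).mp hlt).2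
      obtain ⟨h0, h1, h2, h3⟩ := (hmem x).mp hx
      have hpos := re_neg_one_zpow_mul_normalized_pos (hr _ h1 h2 h3) (hφs x hx)
      rw [hder x h] at hpos
      simp at hpos
    · rw [Multiset.count_eq_zero_of_notMem hx]
      exact zero_le_one
  have hinj : Set.InjOn φ (s.toFinset : Set ℂ) := by
    intro x hx y hy hxy
    rw [Finset.mem_coe, Multiset.mem_toFinset] at hx hy
    have hconv : Convex ℝ {z : ℂ | (0 ≤ z.re ∧ z.re ≤ X ∧ |z.im| ≤ Y) ∧
        |z.re - (n + 1) / 2 - φ x| ≤ 1 / 4} := by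
      intro z hz w hw c d hc hd hcd
      simp only [Set.mem_ofPred_eq, abs_le] at hz hw ⊢
      obtain ⟨⟨hz1, hz2, hz3, hz4⟩, hz5, hz6⟩ := hz
      obtain ⟨⟨hw1, hw2, hw3, hw4⟩, hw5, hw6⟩ := hw
      simp only [add_re, add_im, real_smul, re_ofReal_mul, im_ofReal_mul]
      obtain rfl : d = 1 - c := by linarith
      refine ⟨⟨?_, ?_, ?_, ?_⟩, ?_, ?_⟩ <;> nlinarith
    have h := normalized_injOn hconv (fun z hz => hr z hz.1.1 hz.1.2.1 hz.1.2.2) (fun z hz => hz.2)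
      (x₁ := a * x) (x₂ := a * y) ⟨((hmem x).mp hx).2, hφs x hx⟩
      ⟨((hmem y).mp hy).2, hxy ▸ hφs y hy⟩ (((hmem x).mp hx).1.trans ((hmem y).mp hy).1.symm)
    exact mul_left_cancel₀ ha' h
  have hcard : s.card = (s.toFinset.image φ).card := by
    rw [Finset.card_image_of_injOn hinj, Multiset.toFinset_card_of_nodup hnodup]
  set c : ℝ := (n + 1) / 2 with hc
  have hupper : s.toFinset.image φ ⊆ Finset.Icc ⌈-c - 1 / 4⌉ ⌊X - c + 1 / 4⌋ := by
    intro j hj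
    obtain ⟨x, hx, rfl⟩ := Finset.mem_image.mp hj
    rw [Multiset.mem_toFinset] at hx
    obtain ⟨-, h1, h2, -⟩ := (hmem x).mp hx
    have h := abs_le.mp (hφs x hx)
    rw [Finset.mem_Icc, Int.ceil_le, Int.le_floor]
    exact ⟨by linarith, by linarith⟩
  have hlower : Finset.Icc ⌈-c + 1 / 4⌉ ⌊X - c - 1 / 4⌋ ⊆ s.toFinset.image φ := by
    intro j hj
    rw [Finset.mem_Icc, Int.ceil_le, Int.le_floor] at hj
    have hb (x : ℝ) (hx : |x - ((n + 1 : ℕ) : ℝ) / 2 - j| ≤ 1 / 4) : 0 ≤ x ∧ x ≤ X := by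
      push_cast at hx
      have h := abs_le.mp hx
      exact ⟨by linarith, by linarith⟩
    obtain ⟨x, hx, hx0⟩ := exists_normalized_eq_zero (n := n + 1) (j := j) fun x hx =>
      hr' x (by simpa using (hb x hx).1) (by simpa using (hb x hx).2) (by simpa using hY)
    have hax : (a : ℂ) * ((x / a : ℝ) : ℂ) = x := by
      rw [← ofReal_mul, mul_div_cancel₀ _ ha.ne']
    refine Finset.mem_image.mpr ⟨((x / a : ℝ) : ℂ), ?_, ?_⟩
    · rw [Multiset.mem_toFinset, hmem, hax]
      exact ⟨hx0, by simpa using (hb x hx).1, by simpa using (hb x hx).2, by simpa using hY⟩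
    · rw [hφ]
      simp only [hax, ofReal_re]
      have h := abs_le.mp hx
      rw [round_eq_iff]
      exact ⟨by linarith, by linarith⟩
  have h1 := Finset.card_le_card hupper
  have h2 := Finset.card_le_card hlower
  rw [← hcard, Int.card_Icc] at h1 h2
  have h3 := Int.floor_le (X - c + 1 / 4)
  have h4 := Int.le_ceil (-c - 1 / 4)
  have h5 := Int.lt_floor_add_one (X - c - 1 / 4)
  have h6 := Int.ceil_lt_add_one (-c + 1 / 4)
  have h7 : (s.card : ℝ) ≤ X + 3 := by
    rcases le_total (⌊X - c + 1 / 4⌋ + 1 - ⌈-c - 1 / 4⌉) 0 with h | h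
    · rw [Int.toNat_of_nonpos h] at h1
      have : (s.card : ℝ) ≤ 0 := by exact_mod_cast h1
      linarith
    · have h8 : (s.card : ℤ) ≤ ⌊X - c + 1 / 4⌋ + 1 - ⌈-c - 1 / 4⌉ := by omega
      have h9 : (s.card : ℝ) ≤ ⌊X - c + 1 / 4⌋ + 1 - ⌈-c - 1 / 4⌉ := by exact_mod_cast h8
      linarith
  have h8 : (⌊X - c - 1 / 4⌋ + 1 - ⌈-c + 1 / 4⌉ : ℤ) ≤ s.card := by omega
  have h9 : (⌊X - c - 1 / 4⌋ + 1 - ⌈-c + 1 / 4⌉ : ℝ) ≤ s.card := by exact_mod_cast h8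
  rw [abs_le]
  exact ⟨by linarith, by linarith⟩

end EulerPolynomial

theorem real_zeros_uniformly_distributed (E : ℕ → Polynomial ℂ)
    (hE : ∀ (n : ℕ) (x : ℂ), (E n).eval (x + 1) + (E n).eval x = 2 * x ^ n)
    (b : ℝ) (hb₁ : 0 < b) (hb₂ : b < 1 / (π * Real.exp 1)) :
    ∃ δ₀ : ℝ, 0 < δ₀ ∧ ∀ δ : ℝ, 0 < δ → δ < δ₀ →
      Filter.Tendsto
        (fun n : ℕ =>
          ((((E n).comp (Polynomial.C (n : ℂ) * Polynomial.X)).roots.filter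
              (fun x => 0 ≤ x.re ∧ x.re ≤ b ∧ |x.im| ≤ δ)).card : ℝ) / n)
        Filter.atTop (nhds b) := by
  obtain ⟨δ₀, hδ₀, h⟩ := EulerPolynomial.exists_strip_eventually_norm_remainder_le hb₁ hb₂
  refine ⟨δ₀, hδ₀, fun δ hδ hδδ₀ => ?_⟩
  have hbound := h (1 / 2) (by norm_num)
  rw [← Filter.tendsto_add_atTop_iff_nat 1]
  have hlim : Filter.Tendsto (fun n : ℕ => 3 * (1 / ((n : ℝ) + 1))) Filter.atTop (nhds 0) := by
    have h := tendsto_one_div_add_atTop_nhds_zero_nat (𝕜 := ℝ).const_mul 3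
    rwa [mul_zero] at h
  rw [tendsto_iff_dist_tendsto_zero]
  refine squeeze_zero' (Filter.Eventually.of_forall fun n => dist_nonneg) ?_ hlim
  filter_upwards [hbound, (Filter.tendsto_add_atTop_nat 1).eventually hbound] with n h0 h1
  set a : ℝ := (n : ℝ) + 1 with ha
  have ha0 : 0 < a := by positivity
  have hcast : ((n + 1 : ℕ) : ℝ) = a := by simp [ha]
  have hYle : a * δ ≤ a * δ₀ := by gcongr
  have hcard := EulerPolynomial.abs_card_roots_sub_le (n := n) (X := a * b) (Y := a * δ)
    (by positivity) (by positivity) (fun z hz hz' hz'' => h0 z hz hz' (hz''.trans hYle))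
    (fun z hz hz' hz'' => h1 z hz (hz'.trans (by rw [hcast]; nlinarith))
      (hz''.trans (by rw [hcast]; nlinarith))) ha0
    (p := (E (n + 1)).comp (Polynomial.C ((n + 1 : ℕ) : ℂ) * Polynomial.X)) (by
      rw [EulerPolynomial.eq_map_euler (hE (n + 1))]
      simp [ha])
  have hiff (x : ℂ) : (0 ≤ a * x.re ∧ a * x.re ≤ a * b ∧ |a * x.im| ≤ a * δ) ↔
      (0 ≤ x.re ∧ x.re ≤ b ∧ |x.im| ≤ δ) := by
    rw [mul_nonneg_iff_of_pos_left ha0, mul_le_mul_iff_right₀ ha0, abs_mul, abs_of_pos ha0,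
      mul_le_mul_iff_right₀ ha0]
  simp only [hiff] at hcard
  rw [hcast, Real.dist_eq, div_sub' ha0.ne', abs_div, abs_of_pos ha0, ← div_eq_mul_one_div]
  gcongr
end

section
/- For every η > 0 there exists δ₀ > 0 such that for every δ with 0 < δ < δ₀ there is an integer n₀ with the following property: for all n ≥ n₀, | (1/n) · T_n(δ) − 2/(π e) | < η, where T_n(δ) denotes the number of roots x (counted with multiplicity) of the polynomial x ↦ E_n(n x) satisfying |Re x| ≤ 1/(π e) + δ and |Im x| ≤ δ. In particular, the asymptotic fraction of the zeros of E_n(n x) lying near the real segment [−1/(πe), 1/(πe)] is 2/(πe). -/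
open scoped Real Classical
open Complex

/-- The functional equation characterising the family of Euler polynomials. -/
def IsEulerFamily (E : ℕ → Polynomial ℂ) : Prop :=
  ∀ (n : ℕ) (x : ℂ), (E n).eval (x + 1) + (E n).eval x = 2 * x ^ n

theorem Polynomial.eq_zero_of_eval_add_one_add_eval_s18 (p : Polynomial ℂ)
    (h : ∀ x : ℂ, p.eval (x + 1) + p.eval x = 0) : p = 0 := by
  have key : ∀ k : ℕ, p.eval ((2 * k : ℕ) : ℂ) = p.eval 0 := by
    intro k
    induction k with
    | zero => simp
    | succ k ih =>
      have h1 := h ((2 * k : ℕ) : ℂ)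
      have h2 := h (((2 * k : ℕ) : ℂ) + 1)
      have h3 : ((2 * (k + 1) : ℕ) : ℂ) = ((2 * k : ℕ) : ℂ) + 1 + 1 := by push_cast; ring
      rw [h3, ← ih]
      linear_combination h2 - h1
  have hC : p = Polynomial.C (p.eval 0) := by
    apply Polynomial.eq_of_infinite_eval_eq
    apply Set.infinite_of_injective_forall_mem (f := fun k : ℕ => ((2 * k : ℕ) : ℂ))
    · intro a b hab
      have hab' : 2 * a = 2 * b := Nat.cast_injective hab
      omega
    · intro k
      simpa using key k
  have h0 := h 0
  rw [hC] at h0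
  simp only [Polynomial.eval_C] at h0
  rw [hC, show p.eval 0 = 0 by linear_combination h0 / 2, Polynomial.C_0]

/-- A real polynomial of Bernoulli type satisfying the Euler functional equation. -/
noncomputable def realEuler (n : ℕ) : Polynomial ℝ :=
  Polynomial.C (2 ^ (n + 1) / (n + 1 : ℝ)) *
    (((Polynomial.bernoulli (n + 1)).map (algebraMap ℚ ℝ)).comp
        (Polynomial.C 2⁻¹ * (Polynomial.X + 1)) -
      ((Polynomial.bernoulli (n + 1)).map (algebraMap ℚ ℝ)).comp
        (Polynomial.C 2⁻¹ * Polynomial.X))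

theorem realEuler_eval (n : ℕ) (x : ℝ) :
    (realEuler n).eval x = 2 ^ (n + 1) / (n + 1 : ℝ) *
      (bernoulliFun (n + 1) ((x + 1) / 2) - bernoulliFun (n + 1) (x / 2)) := by
  simp [realEuler, bernoulliFun, div_eq_inv_mul]

theorem bernoulli_comp_X_add_one (n : ℕ) :
    ((Polynomial.bernoulli (n + 1)).map (algebraMap ℚ ℂ)).comp (1 + Polynomial.X) =
      (Polynomial.bernoulli (n + 1)).map (algebraMap ℚ ℂ) +
        ((n + 1 : ℕ) : Polynomial ℂ) * Polynomial.X ^ n := by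
  have h := congrArg (Polynomial.map (algebraMap ℚ ℂ)) (Polynomial.bernoulli_comp_one_add_X (n + 1))
  simpa [Polynomial.map_comp, nsmul_eq_mul] using h

theorem isEulerFamily_realEuler :
    IsEulerFamily (fun n => (realEuler n).map (algebraMap ℝ ℂ)) := by
  intro n x
  have hB : ((Polynomial.bernoulli (n + 1)).map (algebraMap ℚ ℝ)).map (algebraMap ℝ ℂ) =
      (Polynomial.bernoulli (n + 1)).map (algebraMap ℚ ℂ) := by
    rw [Polynomial.map_map]; congr 1
  have h := congrArg (Polynomial.eval (2⁻¹ * x)) (bernoulli_comp_X_add_one n)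
  have hn : (n + 1 : ℂ) ≠ 0 := by exact_mod_cast Nat.succ_ne_zero n
  simp only [realEuler, Polynomial.map_mul, Polynomial.map_sub, Polynomial.map_comp, hB,
    Polynomial.map_C, Polynomial.map_add, Polynomial.map_X, Polynomial.map_one,
    Polynomial.eval_mul, Polynomial.eval_C, Polynomial.eval_sub, Polynomial.eval_comp,
    Polynomial.eval_add, Polynomial.eval_X, Polynomial.eval_one, Polynomial.eval_natCast,
    Polynomial.eval_pow] at h ⊢
  have e1 : (algebraMap ℝ ℂ) 2⁻¹ = 2⁻¹ := by simp
  rw [e1, show (2⁻¹ : ℂ) * (x + 1 + 1) = 1 + 2⁻¹ * x by ring, h]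
  simp only [mul_pow, inv_pow]
  push_cast
  simp
  field_simp
  ring

namespace IsEulerFamily

variable {E : ℕ → Polynomial ℂ}

theorem unique {F : ℕ → Polynomial ℂ} (hE : IsEulerFamily E) (hF : IsEulerFamily F) (n : ℕ) :
    E n = F n := by
  rw [← sub_eq_zero]
  apply Polynomial.eq_zero_of_eval_add_one_add_eval_s18
  intro x
  simp only [Polynomial.eval_sub]
  linear_combination hE n x - hF n x

theorem eval_ofReal (hE : IsEulerFamily E) (n : ℕ) (x : ℝ) :
    (E n).eval (x : ℂ) = ((realEuler n).eval x : ℝ) := by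
  rw [hE.unique isEulerFamily_realEuler n, Polynomial.eval_map_algebraMap]
  exact Polynomial.aeval_algebraMap_apply_eq_algebraMap_eval x _

theorem derivative_succ (hE : IsEulerFamily E) (n : ℕ) :
    Polynomial.derivative (E (n + 1)) = Polynomial.C (n + 1 : ℂ) * E n := by
  rw [← sub_eq_zero]
  apply Polynomial.eq_zero_of_eval_add_one_add_eval_s18
  have hp : (E (n + 1)).comp (Polynomial.X + 1) + E (n + 1) = 2 * Polynomial.X ^ (n + 1) := by
    apply Polynomial.funext
    intro x
    simpa using hE (n + 1) x
  have hd := congrArg Polynomial.derivative hp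
  intro x
  have hx := congrArg (Polynomial.eval x) hd
  have hn := hE n x
  simp [Polynomial.derivative_comp] at hx
  simp only [Polynomial.eval_sub, Polynomial.eval_mul, Polynomial.eval_C]
  linear_combination hx - (n + 1 : ℂ) * hn

theorem zero_eq_one (hE : IsEulerFamily E) : E 0 = 1 := by
  rw [← sub_eq_zero]
  apply Polynomial.eq_zero_of_eval_add_one_add_eval_s18
  intro x
  have := hE 0 x
  simp at this ⊢
  linear_combination this

theorem ne_zero (hE : IsEulerFamily E) (n : ℕ) : E n ≠ 0 := by
  intro h
  have := hE n 1
  simp [h] at this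

theorem norm_eval_add_natCast_sub_le (hE : IsEulerFamily E) (n : ℕ) (y : ℂ) (r : ℝ) (m : ℕ)
    (hr : ∀ j < m, ‖y + j‖ ≤ r) :
    ‖(E n).eval (y + m) - (-1) ^ m * (E n).eval y‖ ≤ 2 * m * r ^ n := by
  induction m with
  | zero => simp
  | succ m ih =>
    have h1 := ih fun j hj => hr j (by omega)
    have h2 := hE n (y + m)
    have h3 : (E n).eval (y + (m + 1 : ℕ)) - (-1) ^ (m + 1) * (E n).eval y =
        2 * (y + m) ^ n - ((E n).eval (y + m) - (-1) ^ m * (E n).eval y) := by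
      push_cast
      rw [← add_assoc, pow_succ]
      linear_combination h2
    rw [h3]
    have h4 : ‖2 * (y + m) ^ n‖ ≤ 2 * r ^ n := by
      rw [norm_mul, norm_pow, Complex.norm_ofNat]
      gcongr
      exact hr m (by omega)
    calc _ ≤ _ := norm_sub_le _ _
      _ ≤ 2 * r ^ n + 2 * m * r ^ n := add_le_add h4 h1
      _ = _ := by push_cast; ring

end IsEulerFamily

theorem hasSum_realEuler {n : ℕ} (hn : 1 ≤ n) {x : ℝ} (hx : x ∈ Set.Icc (0 : ℝ) 1) :
    HasSum (fun j : ℕ => (1 : ℂ) / (j : ℂ) ^ (n + 1) * (((-1) ^ j - 1) *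
        (exp (π * I * j * x) + (-1) ^ (n + 1) * exp (-(π * I * j * x)))))
      (-(π * I) ^ (n + 1) / n.factorial * (realEuler n).eval x) := by
  have h1 := hasSum_one_div_nat_pow_mul_fourier (k := n + 1) (by omega) (x := (x + 1) / 2)
    ⟨by linarith [hx.1], by linarith [hx.2]⟩
  have h2 := hasSum_one_div_nat_pow_mul_fourier (k := n + 1) (by omega) (x := x / 2)
    ⟨by linarith [hx.1], by linarith [hx.2]⟩
  have h := h1.sub h2
  have hval : -(π * I : ℂ) ^ (n + 1) / n.factorial * (realEuler n).eval x =
      -(2 * π * I : ℂ) ^ (n + 1) / (n + 1).factorial * bernoulliFun (n + 1) ((x + 1) / 2) -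
        -(2 * π * I : ℂ) ^ (n + 1) / (n + 1).factorial * bernoulliFun (n + 1) (x / 2) := by
    rw [realEuler_eval, Nat.factorial_succ]
    have : (n + 1 : ℂ) ≠ 0 := by exact_mod_cast Nat.succ_ne_zero n
    have h' : (n.factorial : ℂ) ≠ 0 := by exact_mod_cast n.factorial_ne_zero
    push_cast
    field_simp
    ring
  rw [hval]
  refine h.congr_fun fun j => ?_
  simp only [fourier_coe_apply]
  have e1 : exp (2 * π * I * (j : ℤ) * ((x + 1) / 2 : ℝ) / (1 : ℝ)) =
    (-1) ^ j * exp (π * I * j * x) := by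
    rw [← exp_pi_mul_I, ← exp_nat_mul, ← exp_add]
    congr 1
    push_cast
    ring
  have e2 : exp (2 * π * I * (-(j : ℤ) : ℤ) * ((x + 1) / 2 : ℝ) / (1 : ℝ)) =
    (-1) ^ j * exp (-(π * I * j * x)) := by
    have hj : ((-1 : ℂ)) ^ j = ((-1) ^ j)⁻¹ := by
      rcases neg_one_pow_eq_or ℂ j with h | h <;> simp [h]
    rw [hj, ← exp_pi_mul_I, ← exp_nat_mul, ← exp_neg, ← exp_add]
    congr 1
    push_cast
    ring
  have e3 : exp (2 * π * I * (j : ℤ) * (x / 2 : ℝ) / (1 : ℝ)) = exp (π * I * j * x) := by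
    congr 1; push_cast; ring
  have e4 : exp (2 * π * I * (-(j : ℤ) : ℤ) * (x / 2 : ℝ) / (1 : ℝ)) =
    exp (-(π * I * j * x)) := by
    congr 1; push_cast; ring
  rw [e1, e2, e3, e4]
  ring

theorem norm_realEuler_term_le {n : ℕ} (hn : 1 ≤ n) (x : ℝ) (j : ℕ) :
    ‖(1 : ℂ) / (j : ℂ) ^ (n + 1) * (((-1) ^ j - 1) *
        (exp (π * I * j * x) + (-1) ^ (n + 1) * exp (-(π * I * j * x))))‖ ≤
      4 * (1 / (j : ℝ) ^ 2) := by
  rcases Nat.eq_zero_or_pos j with rfl | hj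
  · simp
  have hj1 : (1 : ℝ) ≤ j := by exact_mod_cast hj
  have e1 : ‖exp (π * I * j * x)‖ = 1 := by
    rw [show π * I * j * x = (π * j * x : ℝ) * I by push_cast; ring, norm_exp_ofReal_mul_I]
  have e2 : ‖exp (-(π * I * j * x))‖ = 1 := by
    rw [exp_neg, norm_inv, e1, inv_one]
  rw [norm_mul, norm_div, norm_pow, norm_one, norm_natCast, norm_mul]
  have b1 : ‖((-1 : ℂ)) ^ j - 1‖ ≤ 2 := by
    refine (norm_sub_le _ _).trans ?_
    norm_num [norm_pow]
  have b2 : ‖exp (π * I * j * x) + (-1) ^ (n + 1) * exp (-(π * I * j * x))‖ ≤ 2 := by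
    refine (norm_add_le _ _).trans ?_
    rw [norm_mul, e1, e2, norm_pow, norm_neg, norm_one]; norm_num
  have b3 : 1 / (j : ℝ) ^ (n + 1) ≤ 1 / (j : ℝ) ^ 2 := by
    apply one_div_le_one_div_of_le (by positivity)
    exact pow_le_pow_right₀ hj1 (by omega)
  calc _ ≤ 1 / (j : ℝ) ^ 2 * (2 * 2) := by gcongr
    _ = _ := by ring

theorem norm_realEuler_sum (n : ℕ) (x : ℝ) :
    ‖-(π * I : ℂ) ^ (n + 1) / n.factorial * (realEuler n).eval x‖ =
      π ^ (n + 1) / n.factorial * |(realEuler n).eval x| := by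
  rw [norm_mul, norm_div, norm_neg, norm_pow, norm_mul, norm_I, mul_one, norm_real, norm_real,
    norm_natCast, Real.norm_of_nonneg Real.pi_pos.le, Real.norm_eq_abs]

theorem abs_realEuler_zero_le (n : ℕ) :
    |(realEuler n).eval 0| ≤ 3 * (n.factorial / π ^ n) := by
  rcases Nat.eq_zero_or_pos n with rfl | hn
  · have h : (realEuler 0).eval 0 = 1 := by
      rw [realEuler_eval]; simp [bernoulliFun_one]
    rw [h]; norm_num
  have h := (hasSum_realEuler hn (x := 0) (by simp)).norm_le_of_bounded
    (hasSum_zeta_two.mul_left 4) (norm_realEuler_term_le hn 0)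
  rw [norm_realEuler_sum] at h
  have hp := Real.pi_pos
  have hp2 := Real.pi_lt_d2
  have hf : (0 : ℝ) < n.factorial := by exact_mod_cast n.factorial_pos
  have e : |(realEuler n).eval 0| =
      (π ^ (n + 1) / n.factorial * |(realEuler n).eval 0|) / π * (n.factorial / π ^ n) := by
    rw [pow_succ]; field_simp
  rw [e]
  gcongr
  calc _ ≤ 4 * (π ^ 2 / 6) / π := by gcongr
    _ = 4 * π / 6 := by field_simp
    _ ≤ 3 := by linarith

theorem exists_le_abs_realEuler {n : ℕ} (hn : 1 ≤ n) :
    ∃ x ∈ Set.Icc (0 : ℝ) 1, 1 / 4 * (n.factorial / π ^ n) ≤ |(realEuler n).eval x| := by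
  obtain ⟨x, hx, h1⟩ : ∃ x ∈ Set.Icc (0 : ℝ) 1,
      ‖exp (π * I * x) + (-1) ^ (n + 1) * exp (-(π * I * x))‖ = 2 := by
    rcases Nat.even_or_odd (n + 1) with h | h
    · refine ⟨0, by simp, ?_⟩
      rw [h.neg_one_pow]; norm_num
    · refine ⟨1 / 2, by norm_num, ?_⟩
      rw [h.neg_one_pow, exp_neg, show π * I * ((1 / 2 : ℝ) : ℂ) = π / 2 * I by push_cast; ring,
        exp_pi_div_two_mul_I, inv_I]
      rw [show I + -1 * -I = 2 * I by ring]
      simp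
  refine ⟨x, hx, ?_⟩
  set t : ℕ → ℂ := fun j => (1 : ℂ) / (j : ℂ) ^ (n + 1) * (((-1) ^ j - 1) *
        (exp (π * I * j * x) + (-1) ^ (n + 1) * exp (-(π * I * j * x)))) with ht
  have ht1 : ‖t 1‖ = 4 := by
    simp only [ht, Nat.cast_one, one_pow, pow_one, mul_one, norm_mul, h1]
    norm_num
  have hs := (hasSum_realEuler hn hx).sub (hasSum_ite_eq 1 (t 1))
  have hz := (hasSum_zeta_two.mul_left 4).sub (hasSum_ite_eq 1 (4 : ℝ))
  have h := hs.norm_le_of_bounded hz (by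
    intro j
    by_cases hj : j = 1
    · subst hj; simp [ht]
    · simp only [hj, if_false, sub_zero]
      exact norm_realEuler_term_le hn x j)
  have h2 := norm_sub_norm_le (t 1) (-(π * I : ℂ) ^ (n + 1) / n.factorial * (realEuler n).eval x)
  rw [norm_sub_rev, norm_realEuler_sum, ht1] at h2
  have hp := Real.pi_pos
  have hp2 := Real.pi_lt_d2
  have hf : (0 : ℝ) < n.factorial := by exact_mod_cast n.factorial_pos
  have e : |(realEuler n).eval x| =
      (π ^ (n + 1) / n.factorial * |(realEuler n).eval x|) / π * (n.factorial / π ^ n) := by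
    rw [pow_succ]; field_simp
  rw [e]
  refine mul_le_mul_of_nonneg_right ?_ (by positivity)
  rw [le_div_iff₀ hp]
  nlinarith

theorem exists_zero_Ioo_of_mul_neg {f : ℝ → ℝ} (hf : Continuous f) {a b : ℝ} (hab : a ≤ b)
    (h : f a * f b < 0) : ∃ z ∈ Set.Ioo a b, f z = 0 := by
  rcases mul_neg_iff.mp h with ⟨h1, h2⟩ | ⟨h1, h2⟩
  · exact intermediate_value_Ioo' hab hf.continuousOn ⟨h2, h1⟩
  · exact intermediate_value_Ioo hab hf.continuousOn ⟨h1, h2⟩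

namespace IsEulerFamily

variable {E : ℕ → Polynomial ℂ}

theorem norm_coeff_le (hE : IsEulerFamily E) (k n : ℕ) :
    ‖(E n).coeff k‖ ≤ 3 * (n.factorial / π ^ n) * (π ^ k / k.factorial) := by
  have hp := Real.pi_pos
  induction k generalizing n with
  | zero =>
    have h := hE.eval_ofReal n 0
    rw [Polynomial.coeff_zero_eq_eval_zero]
    rw [ofReal_zero] at h
    rw [h, norm_real, Real.norm_eq_abs]
    simpa using abs_realEuler_zero_le n
  | succ k ih =>
    cases n with
    | zero => rw [hE.zero_eq_one, Polynomial.coeff_one]; simp; positivity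
    | succ n =>
      have h := congrArg (fun p => Polynomial.coeff p k) (hE.derivative_succ n)
      simp only [Polynomial.coeff_derivative, Polynomial.coeff_C_mul] at h
      have h1 := congrArg norm h
      have hc : ∀ m : ℕ, ‖(m + 1 : ℂ)‖ = m + 1 := fun m => by
        rw [← Nat.cast_add_one, norm_natCast]; push_cast; ring
      rw [norm_mul, norm_mul, hc, hc] at h1
      have hk : (0 : ℝ) < k + 1 := by positivity
      have h2 : ‖(E (n + 1)).coeff (k + 1)‖ = (n + 1) / (k + 1) * ‖(E n).coeff k‖ := by
        field_simp
        linear_combination h1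
      rw [h2, Nat.factorial_succ, Nat.factorial_succ]
      calc _ ≤ (n + 1 : ℝ) / (k + 1) * (3 * (n.factorial / π ^ n) * (π ^ k / k.factorial)) := by
            gcongr; exact ih n
        _ = _ := by
            have : (0 : ℝ) < k.factorial := by exact_mod_cast k.factorial_pos
            push_cast
            rw [pow_succ, pow_succ]
            field_simp

theorem norm_eval_le_exp_norm (hE : IsEulerFamily E) (n : ℕ) (y : ℂ) :
    ‖(E n).eval y‖ ≤ 3 * (n.factorial / π ^ n) * Real.exp (π * ‖y‖) := by
  rw [Polynomial.eval_eq_sum_range]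
  calc _ ≤ ∑ k ∈ Finset.range ((E n).natDegree + 1),
        3 * (n.factorial / π ^ n) * ((π * ‖y‖) ^ k / k.factorial) := by
        refine norm_sum_le_of_le _ fun k _ => ?_
        rw [norm_mul, norm_pow, mul_pow]
        calc _ ≤ 3 * (n.factorial / π ^ n) * (π ^ k / k.factorial) * ‖y‖ ^ k := by
              gcongr; exact hE.norm_coeff_le k n
          _ = _ := by ring
    _ = 3 * (n.factorial / π ^ n) *
        ∑ k ∈ Finset.range ((E n).natDegree + 1), (π * ‖y‖) ^ k / k.factorial := by
        rw [Finset.mul_sum]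
    _ ≤ _ := by
        have := Real.pi_pos
        gcongr
        exact Real.sum_le_exp_of_nonneg (by positivity) _

theorem norm_eval_le (hE : IsEulerFamily E) (n : ℕ) (y : ℂ) :
    ‖(E n).eval y‖ ≤ 3 * (n.factorial / π ^ n) * Real.exp (π * (|y.im| + 1)) +
      2 * (‖y‖ + 1) * ‖y‖ ^ n := by
  have hp := Real.pi_pos
  have base : ∀ w : ℂ, w.im = y.im → |w.re| ≤ 1 →
      ‖(E n).eval w‖ ≤ 3 * (n.factorial / π ^ n) * Real.exp (π * (|y.im| + 1)) := by
    intro w h1 h2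
    refine (hE.norm_eval_le_exp_norm n w).trans ?_
    gcongr
    calc ‖w‖ ≤ |w.re| + |w.im| := norm_le_abs_re_add_abs_im w
      _ ≤ _ := by rw [h1]; linarith
  have hre := abs_re_le_norm y
  have key : ∀ (w : ℂ) (m : ℕ), (∀ j < m, ‖w + j‖ ≤ ‖y‖) → (m : ℝ) ≤ ‖y‖ + 1 →
      ‖(E n).eval (w + m) - (-1) ^ m * (E n).eval w‖ ≤ 2 * (‖y‖ + 1) * ‖y‖ ^ n := by
    intro w m h1 h2
    refine (hE.norm_eval_add_natCast_sub_le n w _ m h1).trans ?_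
    gcongr
  have hsq : ∀ w : ℂ, w.im = y.im → |w.re| ≤ |y.re| → ‖w‖ ≤ ‖y‖ := by
    intro w h1 h2
    rw [norm_def, norm_def, normSq_apply, normSq_apply, h1]
    apply Real.sqrt_le_sqrt
    have := sq_le_sq.mpr h2
    nlinarith
  rcases le_total 0 y.re with h0 | h0
  · set m := ⌊y.re⌋₊ with hm
    have f1 : (m : ℝ) ≤ y.re := Nat.floor_le h0
    have f2 : y.re < m + 1 := Nat.lt_floor_add_one y.re
    have hk := key (y - m) m (by
      intro j hj
      have hj' : (j : ℝ) + 1 ≤ m := by exact_mod_cast hj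
      apply hsq
      · simp
      · simp only [add_re, sub_re, natCast_re]
        have : (0 : ℝ) ≤ j := by positivity
        rw [abs_of_nonneg h0, abs_le]; constructor <;> linarith) (by
      rw [abs_of_nonneg h0] at hre; linarith)
    have hb := base (y - m) (by simp) (by
      simp only [sub_re, natCast_re]; rw [abs_le]; constructor <;> linarith)
    rw [sub_add_cancel] at hk
    have h3 : ‖(-1) ^ m * (E n).eval (y - m)‖ = ‖(E n).eval (y - m)‖ := by simp
    have := norm_sub_norm_le ((E n).eval y) ((-1) ^ m * (E n).eval (y - m))
    linarith
  · set m := ⌈-y.re⌉₊ with hm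
    have f1 : -y.re ≤ m := Nat.le_ceil _
    have f2 : (m : ℝ) < -y.re + 1 := Nat.ceil_lt_add_one (by linarith)
    have hk := key y m (by
      intro j hj
      have hj' : (j : ℝ) + 1 ≤ m := by exact_mod_cast hj
      apply hsq
      · simp
      · simp only [add_re, natCast_re]
        have : (0 : ℝ) ≤ j := by positivity
        rw [abs_of_nonpos h0, abs_le]; constructor <;> linarith) (by
      rw [abs_of_nonpos h0] at hre; linarith)
    have hb := base (y + m) (by simp) (by
      simp only [add_re, natCast_re]; rw [abs_le]; constructor <;> linarith)
    have h3 : ‖(-1) ^ m * (E n).eval y‖ = ‖(E n).eval y‖ := by simp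
    have := norm_sub_norm_le ((-1) ^ m * (E n).eval y) ((E n).eval (y + m))
    rw [norm_sub_rev] at this
    linarith

end IsEulerFamily

theorem abs_realEuler_add_natCast_sub_le (n : ℕ) (y r : ℝ) (m : ℕ)
    (hr : ∀ j < m, |y + j| ≤ r) :
    |(realEuler n).eval (y + m) - (-1) ^ m * (realEuler n).eval y| ≤ 2 * m * r ^ n := by
  have h := isEulerFamily_realEuler.norm_eval_add_natCast_sub_le n y r m (by
    intro j hj
    rw [← ofReal_natCast, ← ofReal_add, norm_real]
    exact hr j hj)
  have h1 := isEulerFamily_realEuler.eval_ofReal n (y + m)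
  have h2 := isEulerFamily_realEuler.eval_ofReal n y
  rw [ofReal_add, ofReal_natCast] at h1
  rw [h1, h2] at h
  rw [← Real.norm_eq_abs, ← norm_real]
  push_cast
  exact h

theorem abs_realEuler_add_intCast_sub_lt {n M : ℕ} {x : ℝ} (hx : x ∈ Set.Icc (0 : ℝ) 1)
    (hM : 2 * M * (M + 1 : ℝ) ^ n < |(realEuler n).eval x|) (k : ℤ) (hk : |k| ≤ M) :
    |(realEuler n).eval (x + k) - (-1) ^ k * (realEuler n).eval x| < |(realEuler n).eval x| := by
  have hb : ∀ m : ℕ, m ≤ M → 2 * m * (M + 1 : ℝ) ^ n < |(realEuler n).eval x| := by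
    intro m hm
    refine lt_of_le_of_lt ?_ hM
    gcongr
  obtain ⟨h0, h1⟩ := hx
  obtain ⟨m, rfl | rfl⟩ := Int.eq_nat_or_neg k
  · have hm : m ≤ M := by simpa using hk
    refine lt_of_le_of_lt ?_ (hb m hm)
    rw [zpow_natCast, Int.cast_natCast]
    apply abs_realEuler_add_natCast_sub_le
    intro j hj
    have : (j : ℝ) ≤ M := by exact_mod_cast (hj.le.trans hm)
    have : (0 : ℝ) ≤ j := by positivity
    rw [abs_le]; constructor <;> linarith
  · have hm : m ≤ M := by simpa using hk
    refine lt_of_le_of_lt ?_ (hb m hm)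
    rw [zpow_neg, zpow_natCast, Int.cast_neg, Int.cast_natCast]
    have h := abs_realEuler_add_natCast_sub_le n (x - m) (M + 1) m (by
      intro j hj
      have hj' : (j : ℝ) ≤ m := by exact_mod_cast hj.le
      have : (m : ℝ) ≤ M := by exact_mod_cast hm
      have : (0 : ℝ) ≤ j := by positivity
      rw [abs_le]; constructor <;> linarith)
    rw [sub_add_cancel] at h
    refine le_trans (le_of_eq ?_) h
    rw [← sub_eq_add_neg]
    rcases neg_one_pow_eq_or ℝ m with e | e
    · rw [e, inv_one, one_mul, one_mul, abs_sub_comm]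
    · rw [e, inv_neg, inv_one]
      congr 1; ring

theorem exists_realEuler_zero {n M : ℕ} {x : ℝ} (hx : x ∈ Set.Icc (0 : ℝ) 1)
    (hM : 2 * M * (M + 1 : ℝ) ^ n < |(realEuler n).eval x|) (k : ℤ) (hk : k ∈ Set.Ico (-M : ℤ) M) :
    ∃ z ∈ Set.Ioo (x + k) (x + k + 1), (realEuler n).eval z = 0 := by
  have h1 := abs_realEuler_add_intCast_sub_lt hx hM k (abs_le.mpr ⟨hk.1, hk.2.le⟩)
  have h2 := abs_realEuler_add_intCast_sub_lt hx hM (k + 1)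
    (abs_le.mpr ⟨by linarith [hk.1], by have := hk.2; omega⟩)
  apply exists_zero_Ioo_of_mul_neg (realEuler n).continuous (by linarith)
  rw [zpow_add_one₀ (by norm_num)] at h2
  push_cast at h2
  rw [← add_assoc] at h2
  generalize (realEuler n).eval (x + k) = u at *
  generalize (realEuler n).eval (x + k + 1) = v at *
  generalize (realEuler n).eval x = w at *
  have hs : ((-1 : ℝ) ^ k = 1) ∨ ((-1 : ℝ) ^ k = -1) := by
    rcases Int.even_or_odd k with h | h
    · exact Or.inl h.neg_one_zpow
    · exact Or.inr h.neg_one_zpow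
  rcases hs with e | e <;> rw [e] at h1 h2 <;> rcases abs_cases w with ⟨hw, hw'⟩ | ⟨hw, hw'⟩ <;>
    rw [hw, abs_lt] at h1 h2
  · exact mul_neg_of_pos_of_neg (by linarith) (by linarith)
  · exact mul_neg_of_neg_of_pos (by linarith) (by linarith)
  · exact mul_neg_of_neg_of_pos (by linarith) (by linarith)
  · exact mul_neg_of_pos_of_neg (by linarith) (by linarith)

theorem Polynomial.sum_posLog_roots (p : Polynomial ℂ) {c : ℂ} {R : ℝ} (hR : 0 < R)
    (hc : p.eval c ≠ 0) :
    (p.roots.map fun z => Real.posLog (R / ‖z - c‖)).sum =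
      Real.circleAverage (fun z => Real.log ‖p.eval z‖) c R - Real.log ‖p.eval c‖ := by
  have hR' : (R : ℂ) ≠ 0 := by exact_mod_cast hR.ne'
  set q := p.comp (Polynomial.C (R : ℂ) * Polynomial.X + Polynomial.C c) with hq
  have h1 : Real.circleAverage (fun z => Real.log ‖p.eval z‖) c R = q.logMahlerMeasure := by
    rw [Real.circleAverage_eq_circleAverage_zero_one, Polynomial.logMahlerMeasure_def]
    simp [hq]
  have h0 : q.eval 0 = p.eval c := by simp [hq]
  have hsp := (IsAlgClosed.splits q).eval_eq_prod_roots 0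
  have hr : q.roots = p.roots.map (fun z => (R : ℂ)⁻¹ * (z - c)) := by
    rw [hq, Polynomial.roots_comp_C_mul_X_add_C p _ _ (isUnit_iff_ne_zero.mpr hR')]
    simp
  have hroot : ∀ z ∈ p.roots, z - c ≠ 0 := by
    intro z hz h
    rw [sub_eq_zero] at h
    exact hc (h ▸ Polynomial.isRoot_of_mem_roots hz)
  have hlead : q.leadingCoeff ≠ 0 := by
    rw [Polynomial.leadingCoeff_ne_zero]
    rintro h
    rw [h] at h0
    exact hc (by simpa using h0.symm)
  have h2 : Real.log ‖p.eval c‖ = Real.log ‖q.leadingCoeff‖ +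
      (p.roots.map fun z => Real.log ‖(R : ℂ)⁻¹ * (z - c)‖).sum := by
    have key : ∀ s : Multiset ℂ, (∀ z ∈ s, z - c ≠ 0) →
        (s.map fun z => 0 - (R : ℂ)⁻¹ * (z - c)).prod ≠ 0 ∧
        Real.log ‖(s.map fun z => 0 - (R : ℂ)⁻¹ * (z - c)).prod‖ =
          (s.map fun z => Real.log ‖(R : ℂ)⁻¹ * (z - c)‖).sum := by
      intro s
      induction s using Multiset.induction_on with
      | empty => simp
      | cons a s ih =>
        intro hs
        obtain ⟨i1, i2⟩ := ih fun z hz => hs z (Multiset.mem_cons_of_mem hz)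
        have ha : 0 - (R : ℂ)⁻¹ * (a - c) ≠ 0 := by
          rw [zero_sub, neg_ne_zero]
          exact mul_ne_zero (inv_ne_zero hR') (hs a (Multiset.mem_cons_self a s))
        rw [Multiset.map_cons, Multiset.prod_cons, Multiset.map_cons, Multiset.sum_cons, norm_mul,
          Real.log_mul (norm_ne_zero_iff.mpr ha) (norm_ne_zero_iff.mpr i1), i2, zero_sub, norm_neg]
        exact ⟨mul_ne_zero (by rwa [zero_sub] at ha) i1, rfl⟩
    obtain ⟨k1, k2⟩ := key p.roots hroot
    rw [← h0, hsp, hr, Multiset.map_map, norm_mul, ← k2]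
    exact Real.log_mul (norm_ne_zero_iff.mpr hlead) (norm_ne_zero_iff.mpr k1)
  rw [h1, Polynomial.logMahlerMeasure_eq_log_leadingCoeff_add_sum_log_roots, h2, hr,
    Multiset.map_map, add_sub_add_left_eq_sub, ← Multiset.sum_map_sub]
  congr 1
  apply Multiset.map_congr rfl
  intro z hz
  have e : R / ‖z - c‖ = ‖(R : ℂ)⁻¹ * (z - c)‖⁻¹ := by
    rw [norm_mul, norm_inv, norm_real, Real.norm_of_nonneg hR.le, mul_inv, inv_inv]
    rfl
  simp only [Function.comp]
  rw [e, eq_sub_iff_add_eq, add_comm, ← eq_sub_iff_add_eq, Real.posLog_sub_posLog_inv]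

theorem integral_abs_sin_add_log (c : ℝ) :
    IntervalIntegrable (fun θ => |Real.sin θ| + c * Real.log |Real.sin θ|) MeasureTheory.volume
      0 (2 * π) ∧
    ∫ θ in (0)..(2 * π), (|Real.sin θ| + c * Real.log |Real.sin θ|) =
      4 - c * (2 * π * Real.log 2) := by
  have i1 : ∀ a b, IntervalIntegrable (fun θ => |Real.sin θ|) MeasureTheory.volume a b :=
    fun a b => Real.continuous_sin.abs.intervalIntegrable a b
  have i2 : ∀ a b, IntervalIntegrable (fun θ => c * Real.log |Real.sin θ|)
      MeasureTheory.volume a b := fun a b => by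
    simp only [Real.log_abs]
    exact IntervalIntegrable.const_mul (by apply intervalIntegrable_log_sin) c
  refine ⟨(i1 _ _).add (i2 _ _), ?_⟩
  set f := fun θ => |Real.sin θ| + c * Real.log |Real.sin θ| with hf
  have hper : ∀ θ, f (θ + π) = f θ := by
    intro θ
    simp only [hf, Real.sin_add_pi, abs_neg]
  have h0 : ∫ θ in (0)..π, f θ = 2 - c * (π * Real.log 2) := by
    rw [hf, intervalIntegral.integral_add (i1 _ _) (i2 _ _), intervalIntegral.integral_const_mul]
    have e1 : ∫ θ in (0)..π, |Real.sin θ| = 2 := by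
      have e2 : ∫ θ in (0)..π, Real.sin θ = 2 := by
        rw [integral_sin, Real.cos_zero, Real.cos_pi]; norm_num
      rw [← e2]
      apply intervalIntegral.integral_congr
      intro θ hθ
      rw [Set.uIcc_of_le Real.pi_pos.le] at hθ
      exact abs_of_nonneg (Real.sin_nonneg_of_mem_Icc hθ)
    simp only [Real.log_abs]
    rw [e1, integral_log_sin_zero_pi]
    ring
  have h1 : ∫ θ in π..(2 * π), f θ = ∫ θ in (0)..π, f θ := by
    have := intervalIntegral.integral_comp_add_right (a := 0) (b := π) f π
    rw [zero_add, ← two_mul] at this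
    rw [← this]
    simp only [hper]
  rw [← intervalIntegral.integral_add_adjacent_intervals (b := π) ((i1 _ _).add (i2 _ _))
    ((i1 _ _).add (i2 _ _)), h1, h0]
  ring

theorem integral_max_abs_sin_le {u : ℝ} (h0 : 0 < u) (h1 : u < 1) :
    ∫ θ in (0)..(2 * π), max |Real.sin θ| u ≤ 4 + u * (2 * π * Real.log 2 / -Real.log u) := by
  have hl : 0 < -Real.log u := by linarith [Real.log_neg h0 h1]
  set c := -(u / -Real.log u) with hc
  have hcn : c ≤ 0 := by rw [hc, neg_nonpos]; positivity
  obtain ⟨hi, he⟩ := integral_abs_sin_add_log c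
  have : 4 + u * (2 * π * Real.log 2 / -Real.log u) = 4 - c * (2 * π * Real.log 2) := by
    rw [hc]; ring
  rw [this, ← he]
  refine intervalIntegral.integral_mono_ae Real.two_pi_pos.le
    ((Real.continuous_sin.abs.max continuous_const).intervalIntegrable _ _) hi ?_
  have hae : ∀ᵐ θ : ℝ, Real.sin θ ≠ 0 := by
    have hcount : {θ : ℝ | Real.sin θ = 0}.Countable := by
      have : {θ : ℝ | Real.sin θ = 0} = Set.range fun n : ℤ => (n : ℝ) * π := by
        ext θ
        exact Real.sin_eq_zero_iff
      rw [this]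
      exact Set.countable_range _
    exact hcount.ae_notMem MeasureTheory.volume
  filter_upwards [hae] with θ hθ
  have hs : 0 < |Real.sin θ| := abs_pos.mpr hθ
  have hs1 : |Real.sin θ| ≤ 1 := Real.abs_sin_le_one θ
  have hlog : Real.log |Real.sin θ| ≤ 0 := Real.log_nonpos hs.le hs1
  apply max_le
  · nlinarith
  · rcases le_total u |Real.sin θ| with h | h
    · nlinarith
    · have h2 : Real.log |Real.sin θ| ≤ Real.log u := Real.log_le_log hs h
      have h3 : c * Real.log u = u := by
        rw [hc, neg_mul, ← mul_neg]
        exact div_mul_cancel₀ u hl.ne'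
      nlinarith

theorem exists_integral_max_abs_sin_le {ε : ℝ} (hε : 0 < ε) :
    ∃ u₀ : ℝ, 0 < u₀ ∧ ∀ u, 0 < u → u < u₀ →
      ∫ θ in (0)..(2 * π), max |Real.sin θ| u ≤ 4 + ε * u := by
  set B := 2 * π * Real.log 2 with hB
  have hBpos : 0 < B := by
    have := Real.log_pos one_lt_two
    have := Real.pi_pos
    positivity
  refine ⟨Real.exp (-(B / ε)), Real.exp_pos _, fun u hu hu' => ?_⟩
  have hlog : Real.log u < -(B / ε) := by
    rwa [Real.log_lt_iff_lt_exp hu]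
  have hBe : 0 < B / ε := by positivity
  have hu1 : u < 1 := hu'.trans (by rw [Real.exp_lt_one_iff]; linarith)
  refine (integral_max_abs_sin_le hu hu1).trans ?_
  have : B / -Real.log u ≤ ε := by
    rw [div_le_iff₀ (by linarith)]
    rw [lt_neg, div_lt_iff₀ hε] at hlog
    linarith
  nlinarith

theorem Multiset.mul_card_filter_sub_le {α : Type*} (Z T : Multiset α) (hT : T ≤ Z) (w : α → ℝ)
    (hw : ∀ z, 0 ≤ w z) (P : α → Prop) [DecidablePred P] {L : ℝ}
    (hL : 0 ≤ L) (hP : ∀ z ∈ Z, P z → L ≤ w z) :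
    L * ((Z.filter P).card - T.card) ≤ (Z.map w).sum - (T.map w).sum := by
  obtain ⟨V, rfl⟩ := Multiset.le_iff_exists_add.mp hT
  have h1 : ((T.filter P).card : ℝ) ≤ T.card := by
    exact_mod_cast Multiset.card_le_card (Multiset.filter_le P T)
  have h2 : L * (V.filter P).card ≤ (V.map w).sum := by
    have hV : ∀ z ∈ V, P z → L ≤ w z := fun z hz => hP z (Multiset.mem_add.mpr (Or.inr hz))
    clear hP hT h1
    induction V using Multiset.induction_on with
    | empty => simp
    | cons a V ih =>
      have := ih fun z hz => hV z (Multiset.mem_cons_of_mem hz)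
      rw [Multiset.map_cons, Multiset.sum_cons]
      by_cases ha : P a
      · rw [Multiset.filter_cons_of_pos _ ha, Multiset.card_cons]
        have := hV a (Multiset.mem_cons_self a V) ha
        push_cast
        linarith
      · rw [Multiset.filter_cons_of_neg _ ha]
        linarith [hw a]
  rw [Multiset.filter_add, Multiset.card_add, Multiset.map_add, Multiset.sum_add]
  push_cast
  nlinarith

theorem log_factorial_le {M : ℕ} (hM : 1 ≤ M) :
    Real.log M.factorial ≤ M * Real.log M - M + 1 + Real.log M := by
  induction M, hM using Nat.le_induction with
  | base => simp
  | succ M hM ih =>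
    have hM' : (0 : ℝ) < M := by exact_mod_cast hM
    rw [Nat.factorial_succ]
    push_cast
    rw [Real.log_mul (by positivity) (by positivity)]
    have h := Real.one_sub_inv_le_log_of_pos (x := (M + 1) / M) (by positivity)
    rw [Real.log_div (by positivity) (by positivity), inv_div] at h
    have h2 : (M + 1 : ℝ) * (1 - M / (M + 1)) = 1 := by field_simp; ring
    nlinarith

theorem div_exp_one_pow_le_factorial {n : ℕ} (hn : 1 ≤ n) :
    (n / Real.exp 1) ^ n ≤ (n.factorial : ℝ) := by
  have hn' : (1 : ℝ) ≤ n := by exact_mod_cast hn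
  refine le_trans (le_mul_of_one_le_left (by positivity) ?_) (Stirling.le_factorial_stirling n)
  rw [Real.one_le_sqrt]
  nlinarith [Real.pi_gt_three]

theorem pow_mul_exp_le_factorial_div {n : ℕ} (hn : 1 ≤ n) (t : ℝ) :
    (n * (Real.exp t / (π * Real.exp 1))) ^ n ≤ n.factorial / π ^ n * Real.exp (n * t) := by
  calc _ = (n / Real.exp 1) ^ n / π ^ n * Real.exp (n * t) := by
        rw [Real.exp_nat_mul, div_pow, mul_pow, div_pow, mul_pow]
        field_simp
    _ ≤ _ := by
        gcongr
        exact div_exp_one_pow_le_factorial hn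

namespace IsEulerFamily

variable {E : ℕ → Polynomial ℂ}

theorem norm_eval_circleMap_le (hE : IsEulerFamily E) {t R : ℝ}
    (hR : R = Real.exp t / (π * Real.exp 1)) {n : ℕ} (hn : 1 ≤ n) {x : ℝ}
    (hx : x ∈ Set.Icc (0 : ℝ) 1) (θ : ℝ) :
    ‖(E n).eval (circleMap x (n * R) θ)‖ ≤
      n.factorial / π ^ n * ((3 * Real.exp π + 2 * (R + 2) * Real.exp (1 / R)) * n) *
        Real.exp (n * (π * R * max |Real.sin θ| (t / (π * R)))) := by
  have hp := Real.pi_pos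
  have hR0 : 0 < R := by rw [hR]; positivity
  have hn' : (1 : ℝ) ≤ n := by exact_mod_cast hn
  set f : ℝ := n.factorial / π ^ n with hf
  have hf0 : 0 < f := by positivity
  set m := max |Real.sin θ| (t / (π * R)) with hm
  set y := circleMap x (n * R) θ with hy
  have him : y.im = n * R * Real.sin θ := by simp [hy, circleMap, Complex.exp_im]
  have hny : ‖y‖ ≤ n * R + 1 := by
    have h1 : ‖(x : ℂ)‖ ≤ 1 := by
      rw [Complex.norm_real, Real.norm_eq_abs, abs_of_nonneg hx.1]; exact hx.2
    have h2 : ‖(n * R : ℂ) * Complex.exp (θ * I)‖ = n * R := by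
      rw [norm_mul, Complex.norm_exp_ofReal_mul_I, norm_mul, Complex.norm_real, Complex.norm_natCast,
        Real.norm_of_nonneg hR0.le, mul_one]
    have h3 := norm_add_le (x : ℂ) ((n * R : ℂ) * Complex.exp (θ * I))
    have h4 : y = x + (n * R : ℂ) * Complex.exp (θ * I) := by simp [hy, circleMap]
    rw [h4]; linarith
  have hpow : (n * R + 1) ^ n ≤ f * Real.exp (n * t) * Real.exp (1 / R) := by
    calc (n * R + 1) ^ n ≤ (n * R * Real.exp (1 / (n * R))) ^ n := by
          gcongr
          have := Real.add_one_le_exp (1 / (n * R))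
          calc n * R + 1 = n * R * (1 / (n * R) + 1) := by field_simp; ring
            _ ≤ _ := by gcongr
      _ = (n * R) ^ n * Real.exp (1 / R) := by
          rw [mul_pow, ← Real.exp_nat_mul]
          congr 2
          field_simp
      _ ≤ _ := by
          gcongr
          rw [hR]
          exact pow_mul_exp_le_factorial_div hn t
  have he1 : Real.exp (n * t) ≤ Real.exp (n * (π * R * m)) := by
    gcongr
    have := le_max_right |Real.sin θ| (t / (π * R))
    rwa [div_le_iff₀ (by positivity), mul_comm] at this
  have he2 : Real.exp (π * (|y.im| + 1)) ≤ Real.exp (n * (π * R * m)) * Real.exp π := by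
    rw [← Real.exp_add, him, abs_mul, abs_of_nonneg (by positivity : 0 ≤ n * R)]
    gcongr
    have : n * (π * R) * |Real.sin θ| ≤ n * (π * R) * m := by
      gcongr; exact le_max_left _ _
    linarith
  set X := Real.exp (n * (π * R * m)) with hX
  calc _ ≤ 3 * f * Real.exp (π * (|y.im| + 1)) + 2 * (‖y‖ + 1) * ‖y‖ ^ n := hE.norm_eval_le n y
    _ ≤ 3 * f * (X * Real.exp π) + 2 * (n * R + 1 + 1) * (n * R + 1) ^ n := by gcongr
    _ ≤ 3 * f * (X * Real.exp π) * n + 2 * (n * R + 2 * n) * (f * X * Real.exp (1 / R)) := by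
        refine add_le_add (le_mul_of_one_le_right (by positivity) hn') ?_
        refine mul_le_mul (by linarith) ?_ (by positivity) (by positivity)
        exact hpow.trans (by gcongr)
    _ = _ := by ring

theorem sum_posLog_roots_le (hE : IsEulerFamily E) {t R ε : ℝ}
    (hR : R = Real.exp t / (π * Real.exp 1))
    (hint : ∫ θ in (0)..(2 * π), max |Real.sin θ| (t / (π * R)) ≤ 4 + ε * (t / (π * R)))
    {n : ℕ} (hn : 1 ≤ n) {x : ℝ} (hx : x ∈ Set.Icc (0 : ℝ) 1)
    (hEx : 1 / 4 * (n.factorial / π ^ n) ≤ |(realEuler n).eval x|) :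
    ((E n).roots.map fun z : ℂ => Real.posLog (n * R / ‖z - x‖)).sum ≤
      n * (2 * R + ε * t / (2 * π)) +
        Real.log (4 * (3 * Real.exp π + 2 * (R + 2) * Real.exp (1 / R)) * n) := by
  have hp := Real.pi_pos
  have hp3 := Real.pi_gt_three
  have hR0 : 0 < R := by rw [hR]; positivity
  have hn' : (1 : ℝ) ≤ n := by exact_mod_cast hn
  set K := 3 * Real.exp π + 2 * (R + 2) * Real.exp (1 / R) with hK
  have hK1 : 1 ≤ K := by
    have h1 := Real.one_le_exp hp.le
    have h2 : 0 ≤ 2 * (R + 2) * Real.exp (1 / R) := by positivity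
    linarith
  have hKn : 1 ≤ K * n := one_le_mul_of_one_le_of_one_le hK1 hn'
  set f : ℝ := n.factorial / π ^ n with hf
  have hf0 : 0 < f := by positivity
  have hfC : ((f⁻¹ : ℝ) : ℂ) ≠ 0 := by exact_mod_cast (inv_pos.2 hf0).ne'
  set p := Polynomial.C ((f⁻¹ : ℝ) : ℂ) * E n with hpdef
  have hroots : p.roots = (E n).roots := Polynomial.roots_C_mul _ hfC
  have hnorm : ∀ z, ‖p.eval z‖ = f⁻¹ * ‖(E n).eval z‖ := by
    intro z
    rw [hpdef, Polynomial.eval_mul, Polynomial.eval_C, norm_mul, Complex.norm_real,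
      Real.norm_of_nonneg (by positivity)]
  have hpx : 1 / 4 ≤ ‖p.eval (x : ℂ)‖ := by
    rw [hnorm, hE.eval_ofReal, Complex.norm_real, Real.norm_eq_abs, inv_mul_eq_div,
      le_div_iff₀ hf0]
    exact hEx
  have hpx0 : p.eval (x : ℂ) ≠ 0 := by
    rw [← norm_pos_iff]; linarith
  set m : ℝ → ℝ := fun θ => max |Real.sin θ| (t / (π * R)) with hm
  have hm0 : ∀ θ, 0 ≤ m θ := fun θ => (abs_nonneg _).trans (le_max_left _ _)
  have hmc : Continuous m := by fun_prop
  have hpt : ∀ θ, Real.log ‖p.eval (circleMap x (n * R) θ)‖ ≤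
      Real.log (K * n) + n * (π * R) * m θ := by
    intro θ
    rcases (norm_nonneg (p.eval (circleMap x (n * R) θ))).eq_or_lt with h0 | h0
    · rw [← h0, Real.log_zero]
      have := Real.log_nonneg hKn
      have := hm0 θ
      positivity
    · calc _ ≤ Real.log (K * n * Real.exp (n * (π * R) * m θ)) := by
            apply Real.log_le_log h0
            rw [hnorm, inv_mul_eq_div, div_le_iff₀ hf0]
            refine (hE.norm_eval_circleMap_le hR hn hx θ).trans (le_of_eq ?_)
            rw [← mul_assoc (n : ℝ)]
            ring
        _ = _ := by rw [Real.log_mul (by positivity) (by positivity), Real.log_exp]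
  rw [← hroots, Polynomial.sum_posLog_roots p (by positivity) hpx0, Real.circleAverage_def]
  have hci : CircleIntegrable (fun z => Real.log ‖p.eval z‖) (x : ℂ) (n * R) := by
    exact ((AnalyticOnNhd.eval_polynomial p).mono
      (Set.subset_univ _)).meromorphicOn.circleIntegrable_log_norm
  have hmono : ∫ θ in (0)..(2 * π), Real.log ‖p.eval (circleMap x (n * R) θ)‖ ≤
      ∫ θ in (0)..(2 * π), (Real.log (K * n) + n * (π * R) * m θ) := by
    apply intervalIntegral.integral_mono_on (by positivity) hci
    · exact Continuous.intervalIntegrable (by fun_prop) _ _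
    · exact fun θ _ => hpt θ
  rw [intervalIntegral.integral_add (Continuous.intervalIntegrable (by fun_prop) _ _)
    (Continuous.intervalIntegrable (by fun_prop) _ _), intervalIntegral.integral_const,
    intervalIntegral.integral_const_mul] at hmono
  have hlogx : -Real.log 4 ≤ Real.log ‖p.eval (x : ℂ)‖ := by
    rw [← Real.log_inv]
    exact Real.log_le_log (by norm_num) (by linarith)
  have hlog4 : Real.log (4 * K * n) = Real.log 4 + Real.log (K * n) := by
    rw [mul_assoc, Real.log_mul (by norm_num) (by positivity)]
  have hsplit : (2 * π)⁻¹ * ((2 * π) * Real.log (K * n) +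
      n * (π * R) * (4 + ε * (t / (π * R)))) =
      Real.log (K * n) + n * (2 * R + ε * t / (2 * π)) := by
    field_simp
    ring
  have hfin : (2 * π)⁻¹ * ∫ θ in (0)..(2 * π), Real.log ‖p.eval (circleMap x (n * R) θ)‖ ≤
      Real.log (K * n) + n * (2 * R + ε * t / (2 * π)) := by
    rw [← hsplit]
    gcongr
    refine hmono.trans ?_
    rw [sub_zero, smul_eq_mul]
    gcongr
  rw [smul_eq_mul, hlog4]
  linarith

end IsEulerFamily

theorem sum_log_succ_eq_log_factorial (M : ℕ) :
    ∑ i : Fin M, Real.log ((i : ℝ) + 1) = Real.log M.factorial := by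
  rw [Fin.sum_univ_eq_sum_range (fun i : ℕ => Real.log ((i : ℝ) + 1)) M]
  induction M with
  | zero => simp
  | succ M ih =>
    rw [Finset.sum_range_succ, ih, Nat.factorial_succ, Nat.cast_mul,
      Real.log_mul (by positivity) (by positivity), Nat.cast_succ, add_comm]

theorem IsEulerFamily.exists_real_roots {E : ℕ → Polynomial ℂ} (hE : IsEulerFamily E) {n M : ℕ}
    {x : ℝ} (hx : x ∈ Set.Icc (0 : ℝ) 1)
    (hM : 2 * M * (M + 1 : ℝ) ^ n < |(realEuler n).eval x|) :
    ∃ T ≤ (E n).roots, T.card = 2 * M ∧ (∀ z ∈ T, |z.re| ≤ M + 1 ∧ z.im = 0) ∧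
      ∀ ρ : ℝ, 0 < ρ → 2 * (M * Real.log ρ - Real.log M.factorial) ≤
        (T.map fun z : ℂ => Real.posLog (ρ / ‖z - x‖)).sum := by
  set k : Fin M ⊕ Fin M → ℤ := Sum.elim (fun i => (i : ℤ)) (fun i => -((i : ℤ) + 1)) with hk
  have hkM : ∀ j, k j ∈ Set.Ico (-M : ℤ) M := by
    rintro (i | i) <;> simp only [hk, Sum.elim_inl, Sum.elim_inr, Set.mem_Ico] <;> omega
  have hkinj : Function.Injective k := by
    rintro (i | i) (j | j) h <;> simp only [hk, Sum.elim_inl, Sum.elim_inr] at h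
    · congr; omega
    · omega
    · omega
    · congr; omega
  choose z hz hz0 using fun j => exists_realEuler_zero hx hM (k j) (hkM j)
  have hzinj : Function.Injective z := by
    intro i j h
    apply hkinj
    have h1 := hz i
    have h2 := hz j
    rw [h] at h1
    have h3 : (k i : ℝ) < k j + 1 := by linarith [h1.1, h2.2]
    have h4 : (k j : ℝ) < k i + 1 := by linarith [h1.2, h2.1]
    have h3' : k i < k j + 1 := by exact_mod_cast h3
    have h4' : k j < k i + 1 := by exact_mod_cast h4
    omega
  let e : (Fin M ⊕ Fin M) ↪ ℂ := ⟨fun j => (z j : ℂ), Complex.ofReal_injective.comp hzinj⟩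
  have hkR : ∀ j, (-M : ℝ) ≤ k j ∧ (k j : ℝ) + 1 ≤ M := by
    intro j
    have := hkM j
    refine ⟨by exact_mod_cast this.1, by exact_mod_cast this.2⟩
  refine ⟨(Finset.univ.map e).val, ?_, ?_, ?_, ?_⟩
  · rw [Finset.val_le_iff_val_subset]
    intro w hw
    obtain ⟨j, -, rfl⟩ := Finset.mem_map.mp (Finset.mem_val.mp hw)
    rw [Polynomial.mem_roots (hE.ne_zero n), Polynomial.IsRoot]
    change (E n).eval ((z j : ℝ) : ℂ) = 0
    rw [hE.eval_ofReal, hz0, Complex.ofReal_zero]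
  · rw [Finset.card_val, Finset.card_map]
    simp [two_mul]
  · intro w hw
    obtain ⟨j, -, rfl⟩ := Finset.mem_map.mp (Finset.mem_val.mp hw)
    refine ⟨?_, Complex.ofReal_im _⟩
    change |((z j : ℝ) : ℂ).re| ≤ _
    rw [Complex.ofReal_re, abs_le]
    have h1 := hz j
    have h2 := hkR j
    exact ⟨by linarith [h1.1, hx.1], by linarith [h1.2, hx.2]⟩
  · intro ρ hρ
    have key : ∀ j (i : ℕ), 0 < |z j - x| → |z j - x| ≤ i + 1 →
        Real.log ρ - Real.log ((i : ℝ) + 1) ≤ Real.posLog (ρ / ‖e j - x‖) := by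
      intro j i h0 h1
      have h2 : ‖e j - x‖ = |z j - x| := by
        change ‖((z j : ℝ) : ℂ) - x‖ = _
        rw [← Complex.ofReal_sub, Complex.norm_real, Real.norm_eq_abs]
      rw [h2, ← Real.log_div hρ.ne' (by positivity)]
      refine le_trans (Real.log_le_log (by positivity) ?_) (le_max_right _ _)
      gcongr
    change _ ≤ ∑ w ∈ Finset.univ.map e, Real.posLog (ρ / ‖w - x‖)
    rw [Finset.sum_map, Fintype.sum_sum_type]
    have hs : M * Real.log ρ - Real.log M.factorial =
        ∑ i : Fin M, (Real.log ρ - Real.log ((i : ℝ) + 1)) := by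
      rw [Finset.sum_sub_distrib, sum_log_succ_eq_log_factorial]
      simp
    rw [two_mul, hs]
    refine add_le_add (Finset.sum_le_sum fun i _ => ?_) (Finset.sum_le_sum fun i _ => ?_)
    · have h := hz (Sum.inl i)
      simp only [hk, Sum.elim_inl, Int.cast_natCast] at h
      have hi : (0 : ℝ) ≤ (i : ℕ) := Nat.cast_nonneg _
      have h0 : 0 < z (Sum.inl i) - x := by linarith [h.1]
      refine key _ i (abs_pos.mpr h0.ne') ?_
      rw [abs_of_pos h0]; linarith [h.2]
    · have h := hz (Sum.inr i)
      simp only [hk, Sum.elim_inr, Int.cast_neg, Int.cast_add, Int.cast_one,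
        Int.cast_natCast] at h
      have hi : (0 : ℝ) ≤ (i : ℕ) := Nat.cast_nonneg _
      have h0 : z (Sum.inr i) - x < 0 := by linarith [h.2]
      refine key _ i (abs_pos.mpr h0.ne) ?_
      rw [abs_of_neg h0]; linarith [h.1]

theorem IsEulerFamily.card_filter_roots_bounds {E : ℕ → Polynomial ℂ} (hE : IsEulerFamily E)
    {t R ε : ℝ} (ht : 0 < t) (hR : R = Real.exp t / (π * Real.exp 1))
    (hint : ∫ θ in (0)..(2 * π), max |Real.sin θ| (t / (π * R)) ≤ 4 + ε * (t / (π * R)))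
    {n : ℕ} (hn : 1 ≤ n) {x : ℝ} (hx : x ∈ Set.Icc (0 : ℝ) 1)
    (hEx : 1 / 4 * (n.factorial / π ^ n) ≤ |(realEuler n).eval x|) {M : ℕ} (hM1 : 1 ≤ M)
    (hMn : M ≤ 1 / (π * Real.exp 1) * n)
    (hM : 2 * M * (M + 1 : ℝ) ^ n < |(realEuler n).eval x|) (P : ℂ → Prop) [DecidablePred P]
    (hP : ∀ z, |z.re| ≤ (M + 1 : ℝ) → z.im = 0 → P z)
    (hP' : ∀ z, P z → ‖z - x‖ ≤ n * (Real.exp (t / 2) / (π * Real.exp 1))) :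
    2 * M ≤ ((E n).roots.filter P).card ∧
      t / 2 * (((E n).roots.filter P).card - 2 * M) ≤
        n * (2 * R + ε * t / (2 * π)) +
          Real.log (4 * (3 * Real.exp π + 2 * (R + 2) * Real.exp (1 / R)) * n) -
            2 * (M * (1 + t) - 1 - Real.log M) := by
  have hp := Real.pi_pos
  have hR0 : 0 < R := by rw [hR]; positivity
  have hn0 : (0 : ℝ) < n := by exact_mod_cast hn
  have hM0 : (0 : ℝ) < M := by exact_mod_cast hM1
  obtain ⟨T, hT, hTc, hTbox, hTsum⟩ := hE.exists_real_roots hx hM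
  refine ⟨?_, ?_⟩
  · rw [← hTc]
    exact Multiset.card_le_card (Multiset.le_filter.mpr
      ⟨hT, fun z hz => hP z (hTbox z hz).1 (hTbox z hz).2⟩)
  have hEx0 : (E n).eval (x : ℂ) ≠ 0 := by
    rw [hE.eval_ofReal, Complex.ofReal_ne_zero, ← abs_pos]
    exact lt_of_lt_of_le (by positivity) hEx
  have hcount := Multiset.mul_card_filter_sub_le (E n).roots T hT
    (fun z : ℂ => Real.posLog (n * R / ‖z - x‖)) (fun z => Real.posLog_nonneg) P
    (L := t / 2) (by positivity) (by
      intro z hz hPz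
      have hzx : 0 < ‖z - x‖ := by
        rw [norm_pos_iff, sub_ne_zero]
        rintro rfl
        exact hEx0 (Polynomial.isRoot_of_mem_roots hz)
      refine le_trans ?_ (le_max_right _ _)
      rw [Real.le_log_iff_exp_le (by positivity), le_div_iff₀ hzx]
      calc _ ≤ Real.exp (t / 2) * (n * (Real.exp (t / 2) / (π * Real.exp 1))) := by
            gcongr; exact hP' z hPz
        _ = n * (Real.exp (t / 2) * Real.exp (t / 2) / (π * Real.exp 1)) := by ring
        _ = _ := by rw [← Real.exp_add, add_halves, hR])
  have hupper := hE.sum_posLog_roots_le hR hint hn hx hEx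
  have hlower := hTsum (n * R) (by positivity)
  have hlogR : Real.log M + t ≤ Real.log (n * R) := by
    rw [Real.le_log_iff_exp_le (by positivity), Real.exp_add, Real.exp_log hM0, hR]
    calc _ ≤ 1 / (π * Real.exp 1) * n * Real.exp t := by gcongr
      _ = _ := by ring
  have hfact := log_factorial_le hM1
  have hmul := mul_le_mul_of_nonneg_left hlogR hM0.le
  rw [hTc] at hcount
  push_cast at hcount
  linarith

theorem one_div_pi_mul_exp_one_le : 1 / (π * Real.exp 1) ≤ 1 / 8 := by
  have h1 := Real.pi_gt_d2
  have h2 := Real.exp_one_gt_d9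
  gcongr
  nlinarith

theorem eventually_log_add_le {c : ℝ} (hc : 0 < c) (A B : ℝ) :
    ∀ᶠ n : ℕ in Filter.atTop, A + B * Real.log n ≤ c * n := by
  have h1 : (fun n : ℕ => A + B * Real.log (n : ℝ)) =o[Filter.atTop] (fun n : ℕ => (n : ℝ)) := by
    refine Asymptotics.IsLittleO.add ?_ (Asymptotics.IsLittleO.const_mul_left ?_ _)
    · exact (Asymptotics.isLittleO_const_id_atTop A).comp_tendsto tendsto_natCast_atTop_atTop
    · exact Real.isLittleO_log_id_atTop.comp_tendsto tendsto_natCast_atTop_atTop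
  filter_upwards [h1.bound hc] with n hn
  rw [Real.norm_natCast] at hn
  exact (Real.le_norm_self _).trans hn

theorem sub_le_of_half_mul_sub_le {a t η n M N R l k m : ℝ} (ha0 : 0 < a) (ha8 : a ≤ 1 / 8)
    (ht : 0 < t) (ht1 : t ≤ 1) (hη : 0 < η) (htη : t ≤ η / 8) (hn0 : 0 < n)
    (hR : R = a * Real.exp t) (hM : (1 - t ^ 2 / 2) * (a * n) < M + 1) (hm : m ≤ l)
    (hl : k + 6 + 3 * l ≤ t * η / 32 * n)
    (h : t / 2 * (N - 2 * M) ≤ n * (2 * R + η / 8 * t / (2 * π)) + (k + l) -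
      2 * (M * (1 + t) - 1 - m)) :
    N - 2 * M ≤ η / 2 * n := by
  have hp := Real.pi_pos
  have hexp : Real.exp t ≤ 1 + t + t ^ 2 := by
    have := Real.abs_exp_sub_one_sub_id_le (x := t) (by rwa [abs_of_pos ht])
    linarith [le_abs_self (Real.exp t - 1 - t)]
  have h1 : 2 * R ≤ 2 * a * (1 + t) + t ^ 2 / 4 := by
    rw [hR]
    have := mul_le_mul_of_nonneg_left hexp ha0.le
    nlinarith [sq_nonneg t]
  have h2 : η / 8 * t / (2 * π) ≤ η * t / 48 := by
    rw [div_le_iff₀ (by positivity)]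
    nlinarith [Real.pi_gt_three, mul_pos hη ht]
  have h3 : (1 - (t ^ 2 / 2)) * (a * n) * (1 + t) - 2 ≤ M * (1 + t) := by nlinarith
  have h4 : n * (2 * R + η / 8 * t / (2 * π)) ≤
      n * (2 * a * (1 + t) + t ^ 2 / 4 + η * t / 48) := by gcongr
  have h5 : (t ^ 2 / 2) * (a * n) * (1 + t) ≤ t ^ 2 / 8 * n := by
    have : a * (1 + t) ≤ 1 / 4 := by nlinarith
    calc _ = (t ^ 2 / 2) * n * (a * (1 + t)) := by ring
      _ ≤ (t ^ 2 / 2) * n * (1 / 4) := by gcongr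
      _ = _ := by ring
  have h6 : t ^ 2 * n ≤ t * (η / 8) * n := by
    rw [sq]; gcongr
  have h7 : t / 2 * (N - 2 * M) ≤ t / 2 * (η / 2 * n) := by
    have h8 : 0 ≤ t * η * n := by positivity
    linarith
  exact le_of_mul_le_mul_left h7 (by positivity)

theorem abs_div_sub_lt_of_le {a ε η n M N : ℝ} (hη : 0 < η) (hn0 : 0 < n)
    (hε : 2 * ε * a ≤ η / 8) (hn : 8 ≤ n * η) (hM : (1 - ε) * (a * n) < M + 1) (hM' : M ≤ a * n)
    (hlow : 2 * M ≤ N) (hupp : N - 2 * M ≤ η / 2 * n) : |N / n - 2 * a| < η := by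
  have hηn : 0 < η * n := by positivity
  have hεn := mul_le_mul_of_nonneg_right hε hn0.le
  rw [abs_lt, lt_sub_iff_add_lt, sub_lt_iff_lt_add, lt_div_iff₀ hn0, div_lt_iff₀ hn0]
  constructor <;> linarith

set_option maxHeartbeats 1000000 in
theorem IsEulerFamily.abs_card_filter_roots_sub_lt {E : ℕ → Polynomial ℂ} (hE : IsEulerFamily E)
    {η : ℝ} (hη : 0 < η) : ∃ δ₀ : ℝ, 0 < δ₀ ∧ ∀ δ : ℝ, 0 < δ → δ < δ₀ →
      ∀ᶠ n : ℕ in Filter.atTop,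
        |((((E n).roots.filter fun z : ℂ => |z.re| ≤ n * (1 / (π * Real.exp 1) + δ) ∧
          |z.im| ≤ n * δ).card : ℝ)) / n - 2 / (π * Real.exp 1)| < η := by
  have hp := Real.pi_pos
  obtain ⟨u₀, hu₀, hu⟩ := exists_integral_max_abs_sin_le (show 0 < η / 8 by positivity)
  obtain ⟨t, ht, ht1, htη, htu⟩ : ∃ t : ℝ, 0 < t ∧ t ≤ 1 ∧ t ≤ η / 8 ∧ t ≤ u₀ / 4 := by
    refine ⟨min 1 (min (η / 8) (u₀ / 4)), by positivity, min_le_left _ _, ?_, ?_⟩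
    · exact (min_le_right _ _).trans (min_le_left _ _)
    · exact (min_le_right _ _).trans (min_le_right _ _)
  set a := 1 / (π * Real.exp 1) with ha
  have ha0 : 0 < a := by positivity
  have ha8 : a ≤ 1 / 8 := one_div_pi_mul_exp_one_le
  obtain ⟨R, hR⟩ : ∃ R, R = Real.exp t / (π * Real.exp 1) := ⟨_, rfl⟩
  have hR0 : 0 < R := by rw [hR]; positivity
  have hRa : R = a * Real.exp t := by rw [hR, ha]; ring
  have hint := hu (t / (π * R)) (by positivity) (by
    rw [div_lt_iff₀ (by positivity)]
    have h1 : 1 / 3 ≤ π * R := by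
      have h2 : π * R = Real.exp t / Real.exp 1 := by rw [hR]; field_simp
      rw [h2]
      have h3 := Real.one_le_exp ht.le
      have h4 := Real.exp_one_lt_three
      gcongr
    nlinarith)
  set ε := t ^ 2 / 2 with hε
  have hε0 : 0 < ε := by positivity
  have hε1 : ε ≤ 1 / 2 := by rw [hε]; nlinarith
  set K := 3 * Real.exp π + 2 * (R + 2) * Real.exp (1 / R) with hK
  have hK0 : 0 < K := by positivity
  have hexp2 : 1 + t / 2 ≤ Real.exp (t / 2) := by linarith [Real.add_one_le_exp (t / 2)]
  refine ⟨a * t / 8, by positivity, fun δ hδ hδ' => ?_⟩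
  have hev1 := (tendsto_self_mul_const_pow_of_lt_one (r := 1 - ε / 2) (by linarith)
    (by linarith)).eventually_lt_const (show (0 : ℝ) < 1 / 8 by norm_num)
  have hlarge : ∀ c : ℝ, ∀ᶠ n : ℕ in Filter.atTop, c ≤ n := fun c =>
    tendsto_natCast_atTop_atTop.eventually_ge_atTop c
  filter_upwards [hev1, hlarge (2 / (a * ε)), hlarge (4 / (a * t)), hlarge (8 / η),
    eventually_log_add_le (show 0 < t * η / 32 by positivity) (Real.log (4 * K) + 6) 3,
    Filter.eventually_ge_atTop 1] with n hn1 hn2 hn3 hn4 hn5 hn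
  have hn0 : (0 : ℝ) < n := by exact_mod_cast hn
  have hn1' : (1 : ℝ) ≤ n := by exact_mod_cast hn
  rw [div_le_iff₀ (by positivity)] at hn2 hn3 hn4
  obtain ⟨x, hx, hEx⟩ := exists_le_abs_realEuler hn
  set M := ⌊(1 - ε) * (a * n)⌋₊ with hMdef
  have han : 0 < a * n := by positivity
  have hMle : (M : ℝ) ≤ (1 - ε) * (a * n) :=
    Nat.floor_le (mul_nonneg (by linarith) han.le)
  have hMge : (1 - ε) * (a * n) < M + 1 := Nat.lt_floor_add_one _
  have hMle' : (M : ℝ) ≤ a * n := hMle.trans (by nlinarith)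
  have hM1 : 1 ≤ M := Nat.le_floor (by push_cast; nlinarith)
  have hM1' : (1 : ℝ) ≤ M := by exact_mod_cast hM1
  have hMn : (M : ℝ) ≤ n := by nlinarith
  have hMs : (M + 1 : ℝ) ≤ (1 - ε / 2) * (a * n) := by linarith
  have hM : 2 * M * (M + 1 : ℝ) ^ n < |(realEuler n).eval x| := by
    have hpow : (a * n) ^ n ≤ n.factorial / π ^ n := by
      have := pow_mul_exp_le_factorial_div hn 0
      rwa [mul_zero, Real.exp_zero, mul_one, mul_comm] at this
    calc _ ≤ 2 * n * ((1 - ε / 2) * (a * n)) ^ n := by gcongr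
      _ = 2 * (n * (1 - ε / 2) ^ n) * (a * n) ^ n := by rw [mul_pow]; ring
      _ < 2 * (1 / 8) * (a * n) ^ n := by gcongr
      _ ≤ 1 / 4 * (n.factorial / π ^ n) := by linarith
      _ ≤ _ := hEx
  obtain ⟨hlow, hupp⟩ := hE.card_filter_roots_bounds ht hR hint hn hx hEx hM1 hMle' hM
    (fun z => |z.re| ≤ n * (a + δ) ∧ |z.im| ≤ n * δ)
    (fun z h1 h2 => ⟨h1.trans (by nlinarith), by rw [h2, abs_zero]; positivity⟩)
    (fun z hz => by
      have h1 : ‖(x : ℂ)‖ ≤ 1 := by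
        rw [Complex.norm_real, Real.norm_eq_abs, abs_of_nonneg hx.1]; exact hx.2
      have h2 := norm_sub_le z x
      have h3 := Complex.norm_le_abs_re_add_abs_im z
      have h4 : n * (Real.exp (t / 2) / (π * Real.exp 1)) = a * n * Real.exp (t / 2) := by
        rw [ha]; ring
      rw [h4]
      have h5 := mul_le_mul_of_nonneg_left hexp2 han.le
      have h6 := mul_lt_mul_of_pos_left hδ' hn0
      linarith [hz.1, hz.2])
  set N := ((E n).roots.filter fun z : ℂ => |z.re| ≤ n * (a + δ) ∧ |z.im| ≤ n * δ).card with hN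
  have hlow' : 2 * (M : ℝ) ≤ N := by exact_mod_cast hlow
  have hlogM : Real.log M ≤ Real.log n := Real.log_le_log (by linarith) hMn
  have hlogK : Real.log (4 * K * n) = Real.log (4 * K) + Real.log n :=
    Real.log_mul (by positivity) (by positivity)
  have hdiff : (N : ℝ) - 2 * M ≤ η / 2 * n := by
    rw [hlogK] at hupp
    exact sub_le_of_half_mul_sub_le ha0 ha8 ht ht1 hη htη hn0 hRa hMge hlogM hn5 hupp
  have h2a : 2 / (π * Real.exp 1) = 2 * a := by rw [ha]; ring
  have hεη : 2 * ε * a ≤ η / 8 := by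
    have : t ^ 2 ≤ t := by nlinarith
    rw [hε]; nlinarith
  rw [h2a]
  exact abs_div_sub_lt_of_le hη hn0 hεη hn4 hMge hMle' hlow' hdiff

theorem real_zero_fraction (E : ℕ → Polynomial ℂ)
    (hE : ∀ (n : ℕ) (x : ℂ), (E n).eval (x + 1) + (E n).eval x = 2 * x ^ n) :
    ∀ η : ℝ, 0 < η → ∃ δ₀ : ℝ, 0 < δ₀ ∧ ∀ δ : ℝ, 0 < δ → δ < δ₀ →
      ∃ n₀ : ℕ, ∀ n : ℕ, n₀ ≤ n →
        |((((E n).comp (Polynomial.C (n : ℂ) * Polynomial.X)).roots.filter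
              (fun x => |x.re| ≤ 1 / (π * Real.exp 1) + δ ∧ |x.im| ≤ δ)).card : ℝ) / n
            - 2 / (π * Real.exp 1)| < η := by
  intro η hη
  obtain ⟨δ₀, hδ₀, h⟩ := IsEulerFamily.abs_card_filter_roots_sub_lt (E := E) hE hη
  refine ⟨δ₀, hδ₀, fun δ hδ hδ' => ?_⟩
  rw [← Filter.eventually_atTop]
  filter_upwards [h δ hδ hδ', Filter.eventually_ge_atTop 1] with n hn hn1
  have hn0 : (0 : ℝ) < n := by exact_mod_cast hn1
  have hnC : (n : ℂ) ≠ 0 := by exact_mod_cast hn0.ne'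
  have hroots := Polynomial.roots_comp_C_mul_X_add_C (E n) (n : ℂ) 0 hnC.isUnit
  rw [Polynomial.C_0, add_zero] at hroots
  rw [hroots, Multiset.filter_map, Multiset.card_map]
  convert hn using 7 with z
  have hz : Ring.inverse (n : ℂ) * (z - 0) = ((n : ℝ)⁻¹ : ℝ) * z := by simp
  simp only [Function.comp_apply, hz, Complex.re_ofReal_mul, Complex.im_ofReal_mul, abs_mul,
    abs_inv, Nat.abs_cast, inv_mul_le_iff₀ hn0]
end
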